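/- arXiv:1008.1426 — 6 statements merged into one kernel-verified Lean document; each statement's English description precedes it below -/
import Mathlib

section
/- Every Schur polynomial S_ν with ν a partition of k parts satisfying ν_1 ≤ n-k+1 and ν_k ≥ k can be written as a ℤ-linear combination of skew Schur polynomials S_{λ/μ} where each λ/μ satisfies λ_1 ≤ n-k+1, λ_k ≥ k, μ_1 ≤ c-k, λ_i - μ_i ≥ k for all i, and λ_1 - λ_k ≤ n-c-k+1, for any fixed c with k ≤ c ≤ n/2. -/
open Matrix

/-- Formal algebraically independent variables `h_1, …, h_n`, with `h_0 = 1` and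
`h_d = 0` for `d < 0` or `d > n`. -/
noncomputable def Hf (n : ℕ) (d : ℤ) : MvPolynomial ℕ ℤ :=
  if d = 0 then 1 else if 1 ≤ d ∧ d ≤ (n : ℤ) then MvPolynomial.X d.toNat else 0

/-- The skew Schur polynomial `S_{λ/μ} = det(h_{λ_i - μ_j - i + j})` (Jacobi–Trudi). -/
noncomputable def skewSchur (n k : ℕ) (lam mu : Fin k → ℕ) : MvPolynomial ℕ ℤ :=
  (Matrix.of fun i j : Fin k =>
    Hf n ((lam i : ℤ) - (mu j : ℤ) - ((i : ℕ) + 1) + ((j : ℕ) + 1))).det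

open MvPolynomial in
/-- generalized alternant -/
noncomputable def alt8 {k : ℕ} (B : Fin k → ℕ) : MvPolynomial (Fin k) ℤ :=
  (Matrix.of fun i j : Fin k => (X i : MvPolynomial (Fin k) ℤ) ^ (B j)).det

lemma alt8_dvd {k : ℕ} (B : Fin k → ℕ) :
    ∃ s, alt8 B = s * alt8 (fun j : Fin k => (j : ℕ)) := by
  classical
  let P : Polynomial (MvPolynomial (Fin k) ℤ) := ∏ i : Fin k, (Polynomial.X - Polynomial.C (MvPolynomial.X i))
  have hP : P.Monic := Polynomial.monic_prod_of_monic _ _ fun i _ => Polynomial.monic_X_sub_C _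
  have hdeg : P.natDegree = k := by
    rw [Polynomial.natDegree_prod_of_monic]
    · simp
    · exact fun i _ => Polynomial.monic_X_sub_C _
  let r : Fin k → Polynomial (MvPolynomial (Fin k) ℤ) := fun j => (Polynomial.X ^ (B j)) %ₘ P
  refine ⟨(Matrix.of fun l j : Fin k => (r j).coeff l).det, ?_⟩
  rw [mul_comm, alt8, alt8, ← Matrix.det_mul]
  congr 1
  ext1 i j
  rw [Matrix.mul_apply]
  simp only [Matrix.of_apply]
  have hroot : P.IsRoot (MvPolynomial.X i) := by
    simp only [P, Polynomial.IsRoot, Polynomial.eval_prod]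
    exact Finset.prod_eq_zero (Finset.mem_univ i) (by simp)
  have h1 : (r j).eval (MvPolynomial.X i) = (MvPolynomial.X i : MvPolynomial (Fin k) ℤ) ^ (B j) := by
    have := congrArg (Polynomial.eval (MvPolynomial.X i)) (Polynomial.modByMonic_add_div (Polynomial.X ^ (B j)) P)
    rw [Polynomial.eval_add, Polynomial.eval_mul, hroot.eq_zero] at this
    simpa [r] using this
  have h2 : (r j).natDegree < k ∨ k = 0 := by
    by_cases h : k = 0
    · exact Or.inr h
    · left
      have := Polynomial.natDegree_modByMonic_lt (Polynomial.X ^ (B j)) hP (by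
        intro h1; rw [h1] at hdeg; simp at hdeg; omega)
      rwa [hdeg] at this
  rcases h2 with h2 | h2
  · rw [← h1, Polynomial.eval_eq_sum_range' h2, ← Fin.sum_univ_eq_sum_range (fun l => (r j).coeff l * (MvPolynomial.X i : MvPolynomial (Fin k) ℤ) ^ l)]
    exact Finset.sum_congr rfl fun l _ => mul_comm _ _
  · subst h2; exact i.elim0

/-- exponent as finsupp -/
noncomputable def ex8 {k : ℕ} (B : Fin k → ℕ) : Fin k →₀ ℕ := Finsupp.equivFunOnFinite.symm B

@[simp] lemma ex8_apply {k : ℕ} (B : Fin k → ℕ) (i : Fin k) : ex8 B i = B i := rfl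

lemma alt8_eq {k : ℕ} (B : Fin k → ℕ) :
    alt8 B = ∑ σ : Equiv.Perm (Fin k),
      MvPolynomial.monomial (ex8 (B ∘ σ)) ((Equiv.Perm.sign σ : ℤˣ) : ℤ) := by
  rw [alt8, ← Matrix.det_transpose, Matrix.det_apply]
  refine Finset.sum_congr rfl fun σ _ => ?_
  rw [MvPolynomial.monomial_eq, Finsupp.prod_fintype _ _ (by simp)]
  simp only [Matrix.transpose_apply, Matrix.of_apply, ex8_apply, Function.comp]
  rw [Units.smul_def, zsmul_eq_mul]
  simp

lemma alt8_rename {k : ℕ} (B : Fin k → ℕ) (σ : Equiv.Perm (Fin k)) :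
    MvPolynomial.rename σ (alt8 B) = ((Equiv.Perm.sign σ : ℤˣ) : ℤ) • alt8 B := by
  have := Matrix.det_permute σ (Matrix.of fun i j : Fin k => (MvPolynomial.X i : MvPolynomial (Fin k) ℤ) ^ (B j))
  rw [alt8, AlgHom.map_det, zsmul_eq_mul, ← this]
  congr 1
  ext1 i j
  simp

lemma alt8_ne_zero {k : ℕ} : alt8 (fun j : Fin k => (j : ℕ)) ≠ 0 := by
  have : alt8 (fun j : Fin k => (j : ℕ)) = (Matrix.vandermonde (fun i : Fin k => (MvPolynomial.X i : MvPolynomial (Fin k) ℤ))).det := rfl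
  rw [this, Matrix.det_vandermonde_ne_zero_iff]
  exact MvPolynomial.X_injective

/-- weight -/
def wt8 {k : ℕ} (w : Fin k → ℕ) (m : Fin k →₀ ℕ) : ℕ := ∑ i, w i * m i

def IsTop8 {k : ℕ} (w : Fin k → ℕ) (p : MvPolynomial (Fin k) ℤ) (b : Fin k →₀ ℕ) : Prop :=
  p.coeff b = 1 ∧ ∀ m, p.coeff m ≠ 0 → m ≠ b → wt8 w m < wt8 w b

noncomputable def phi8 {k : ℕ} (w : Fin k → ℕ) :
    MvPolynomial (Fin k) ℤ →ₐ[ℤ] Polynomial (MvPolynomial (Fin k) ℤ) :=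
  MvPolynomial.aeval fun i => Polynomial.C (MvPolynomial.X i) * Polynomial.X ^ (w i)

lemma phi8_monomial {k : ℕ} (w : Fin k → ℕ) (m : Fin k →₀ ℕ) (c : ℤ) :
    phi8 w (MvPolynomial.monomial m c) =
      Polynomial.monomial (wt8 w m) (MvPolynomial.monomial m c) := by
  rw [phi8, MvPolynomial.aeval_monomial, MvPolynomial.monomial_eq (s := m),
    Finsupp.prod_fintype _ _ (by simp), Finsupp.prod_fintype _ _ (by simp), wt8]
  simp only [mul_pow, Finset.prod_mul_distrib, ← pow_mul, Finset.prod_pow_eq_pow_sum,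
    ← Polynomial.C_mul_X_pow_eq_monomial, map_mul, map_prod, map_pow]
  rw [mul_assoc]
  congr 1

lemma phi8_coeff {k : ℕ} (w : Fin k → ℕ) (p : MvPolynomial (Fin k) ℤ) (e : ℕ) (m : Fin k →₀ ℕ) :
    ((phi8 w p).coeff e).coeff m = if wt8 w m = e then p.coeff m else 0 := by
  classical
  induction p using MvPolynomial.induction_on' with
  | monomial u a =>
    rw [phi8_monomial, Polynomial.coeff_monomial]
    by_cases h : u = m
    · subst h; split_ifs <;> simp
    · split_ifs <;> simp [MvPolynomial.coeff_monomial, h]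
  | add p q hp hq =>
    rw [map_add, Polynomial.coeff_add, MvPolynomial.coeff_add, hp, hq, MvPolynomial.coeff_add]
    split_ifs <;> simp

lemma IsTop8.lead {k : ℕ} {w : Fin k → ℕ} {p : MvPolynomial (Fin k) ℤ} {b : Fin k →₀ ℕ}
    (h : IsTop8 w p b) : (phi8 w p).natDegree = wt8 w b ∧
      (phi8 w p).leadingCoeff = MvPolynomial.monomial b 1 := by
  classical
  have hc : (phi8 w p).coeff (wt8 w b) = MvPolynomial.monomial b 1 := by
    ext m
    rw [phi8_coeff, MvPolynomial.coeff_monomial]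
    by_cases hm : b = m
    · subst hm; simp [h.1]
    · simp only [hm, if_false, ite_eq_right_iff]
      intro h1
      by_contra h2
      exact absurd (h.2 m h2 (Ne.symm hm)) (by omega)
  have hd : (phi8 w p).natDegree = wt8 w b := by
    apply Polynomial.natDegree_eq_of_le_of_coeff_ne_zero
    · rw [Polynomial.natDegree_le_iff_coeff_eq_zero]
      intro N hN
      ext m
      rw [phi8_coeff, MvPolynomial.coeff_zero]
      split_ifs with h1
      · by_contra h2
        by_cases hm : m = b
        · subst hm; omega
        · have := h.2 m h2 hm; omega
      · rfl
    · rw [hc]; simp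
  exact ⟨hd, by rw [Polynomial.leadingCoeff, hd, hc]⟩

lemma wt8_add {k : ℕ} (w : Fin k → ℕ) (a b : Fin k →₀ ℕ) : wt8 w (a + b) = wt8 w a + wt8 w b := by
  simp [wt8, mul_add, Finset.sum_add_distrib]

lemma IsTop8.div {k : ℕ} {w : Fin k → ℕ} {s q : MvPolynomial (Fin k) ℤ} {b d : Fin k →₀ ℕ}
    (hp : IsTop8 w (s * q) (b + d)) (hq : IsTop8 w q d) : IsTop8 w s b := by
  classical
  obtain ⟨hp1, hp2⟩ := hp.lead
  obtain ⟨hq1, hq2⟩ := hq.lead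
  rw [map_mul] at hp1 hp2
  have hne : phi8 w s * phi8 w q ≠ 0 := by
    intro h; rw [h, Polynomial.leadingCoeff_zero] at hp2
    exact one_ne_zero (MvPolynomial.monomial_eq_zero.mp hp2.symm)
  rw [Polynomial.natDegree_mul (left_ne_zero_of_mul hne) (right_ne_zero_of_mul hne), hq1, wt8_add] at hp1
  have hl : (phi8 w s).leadingCoeff = MvPolynomial.monomial b 1 := by
    rw [Polynomial.leadingCoeff_mul, hq2] at hp2
    apply mul_right_cancel₀ (b := (MvPolynomial.monomial d (1:ℤ))) (by simp)
    rw [hp2, MvPolynomial.monomial_mul]; simp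
  have hd : (phi8 w s).natDegree = wt8 w b := by omega
  rw [Polynomial.leadingCoeff, hd] at hl
  constructor
  · have := phi8_coeff w s (wt8 w b) b
    rw [hl] at this; simpa using this.symm
  · intro m hm hne
    have h1 := phi8_coeff w s (wt8 w m) m
    rw [if_pos rfl] at h1
    have h2 : wt8 w m ≤ wt8 w b := by
      rw [← hd]; apply Polynomial.le_natDegree_of_ne_zero
      intro h; rw [h] at h1; simp at h1; exact hm h1.symm
    refine lt_of_le_of_ne h2 fun h => ?_
    rw [h, hl, MvPolynomial.coeff_monomial, if_neg (Ne.symm hne)] at h1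
    exact hm h1.symm

lemma perm8_lt {k : ℕ} {α : Type*} [CommRing α] [LinearOrder α] [IsStrictOrderedRing α]
    {w B : Fin k → α} (hw : StrictMono w) (hB : StrictMono B)
    (σ : Equiv.Perm (Fin k)) (hσ : σ ≠ 1) : ∑ i, w i * B (σ i) < ∑ i, w i * B i := by
  have hmv : Monovary w B := hw.monotone.monovary hB.monotone
  rw [hmv.sum_mul_comp_perm_lt_sum_mul_iff]
  intro h
  apply hσ
  have hm : StrictMono σ := by
    intro i j hij
    by_contra h1
    have h2 : σ j < σ i := lt_of_le_of_ne (not_lt.mp h1) (fun h => hij.ne (σ.injective h).symm)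
    have := h (i := j) (j := i) (hB h2)
    exact absurd (hw hij) (not_lt.mpr this)
  ext i
  have := Subsingleton.elim (σ.toOrderIso hm.monotone (by
    intro a b hab
    by_contra h1
    have := hm (not_le.mp h1); simp at this; exact absurd hab (not_le.mpr this))) (OrderIso.refl (Fin k))
  exact congrArg (fun f : Fin k ≃o Fin k => (f i : ℕ)) this

lemma alt8_top {k : ℕ} {w B : Fin k → ℕ} (hw : StrictMono w) (hB : StrictMono B) :
    IsTop8 w (alt8 B) (ex8 B) := by
  classical
  have key : ∀ σ : Equiv.Perm (Fin k), σ ≠ 1 → wt8 w (ex8 (B ∘ σ)) < wt8 w (ex8 B) := by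
    intro σ hσ
    have := perm8_lt (α := ℤ) (w := fun i => (w i : ℤ)) (B := fun i => (B i : ℤ))
      (fun i j h => Int.ofNat_lt.mpr (hw h)) (fun i j h => Int.ofNat_lt.mpr (hB h)) σ hσ
    simp only [wt8, ex8_apply, Function.comp]
    exact_mod_cast this
  constructor
  · rw [alt8_eq, MvPolynomial.coeff_sum, Finset.sum_eq_single 1]
    · simp [MvPolynomial.coeff_monomial]
    · intro σ _ hσ
      rw [MvPolynomial.coeff_monomial, if_neg]
      intro h
      have := key σ hσ
      rw [h] at this; omega
    · simp
  · intro m hm hne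
    rw [alt8_eq, MvPolynomial.coeff_sum] at hm
    obtain ⟨σ, _, h⟩ := Finset.exists_ne_zero_of_sum_ne_zero hm
    rw [MvPolynomial.coeff_monomial] at h
    have h1 : ex8 (B ∘ σ) = m := by by_contra h2; simp [h2] at h
    subst h1
    apply key
    rintro rfl
    exact hne rfl

/-- The generic quotient polynomial and its properties. -/
lemma quot8 {k : ℕ} {B : Fin k → ℕ} (hB : StrictMono B) (M : Fin k →₀ ℕ)
    (hM : ∀ i, B i = M i + i) :
    ∃ s, alt8 B = s * alt8 (fun j : Fin k => (j : ℕ)) ∧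
      (∀ w : Fin k → ℕ, StrictMono w → IsTop8 w s M) ∧
      (∀ (σ : Equiv.Perm (Fin k)) (m : Fin k →₀ ℕ), s.coeff m ≠ 0 → s.coeff (ex8 (m ∘ σ)) ≠ 0) := by
  obtain ⟨s, hs⟩ := alt8_dvd B
  refine ⟨s, hs, ?_, ?_⟩
  · intro w hw
    apply IsTop8.div (q := alt8 (fun j : Fin k => (j : ℕ))) (d := ex8 (fun j : Fin k => (j : ℕ)))
    · rw [← hs]
      convert alt8_top hw hB using 1
      ext i; simp [hM]
    · exact alt8_top hw (fun i j h => h)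
  · intro σ m hm
    have h1 := congrArg (MvPolynomial.rename σ.symm) hs
    rw [map_mul, alt8_rename, alt8_rename, hs, mul_smul_comm] at h1
    have h2 : MvPolynomial.rename σ.symm s = s := by
      apply mul_right_cancel₀ (alt8_ne_zero (k := k))
      rcases Int.units_eq_one_or (Equiv.Perm.sign σ.symm) with h | h <;> rw [h] at h1 <;>
        simpa [eq_comm] using h1
    have h3 : ex8 (m ∘ σ) = m.mapDomain σ.symm := by
      ext i
      rw [ex8_apply, Function.comp, ← Equiv.symm_apply_apply σ i]
      rw [Finsupp.mapDomain_apply σ.symm.injective]; simp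
    rw [h3, ← h2, MvPolynomial.coeff_rename_mapDomain _ σ.symm.injective]
    exact hm

noncomputable def D8 {R : Type*} [CommRing R] {k : ℕ} (h : ℤ → R) (A : Fin k → ℤ) (B : Fin k → ℕ) : R :=
  (Matrix.of fun i j : Fin k => h (A i + B j)).det

noncomputable def L8 {R : Type*} [CommRing R] {k : ℕ} (h : ℤ → R) (A : Fin k → ℤ) :
    MvPolynomial (Fin k) ℤ →ₗ[ℤ] R :=
  (MvPolynomial.basisMonomials (Fin k) ℤ).constr ℤ (fun m => ∏ i, h (A i + m i))

lemma L8_monomial {R : Type*} [CommRing R] {k : ℕ} (h : ℤ → R) (A : Fin k → ℤ)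
    (m : Fin k →₀ ℕ) (c : ℤ) :
    L8 h A (MvPolynomial.monomial m c) = c • ∏ i, h (A i + m i) := by
  have h1 : MvPolynomial.monomial m c = c • MvPolynomial.basisMonomials (Fin k) ℤ m := by
    rw [MvPolynomial.coe_basisMonomials, MvPolynomial.smul_monomial, smul_eq_mul, mul_one]
  rw [h1, map_smul, L8, Module.Basis.constr_basis]

lemma L8_alt {R : Type*} [CommRing R] {k : ℕ} (h : ℤ → R) (A : Fin k → ℤ) (B : Fin k → ℕ) :
    L8 h A (alt8 B) = D8 h A B := by
  rw [alt8_eq, map_sum, D8, ← Matrix.det_transpose, Matrix.det_apply]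
  refine Finset.sum_congr rfl fun σ _ => ?_
  rw [L8_monomial, Units.smul_def]
  simp

lemma L8_mul {R : Type*} [CommRing R] {k : ℕ} (h : ℤ → R) (A : Fin k → ℤ)
    (m : Fin k →₀ ℕ) (c : ℤ) (p : MvPolynomial (Fin k) ℤ) :
    L8 h A (MvPolynomial.monomial m c * p) = c • L8 h (fun i => A i + m i) p := by
  induction p using MvPolynomial.induction_on' with
  | monomial u a =>
    rw [MvPolynomial.monomial_mul, L8_monomial, L8_monomial, mul_smul]
    simp [add_assoc]
  | add p q hp hq => rw [mul_add, map_add, hp, hq, map_add, smul_add]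

lemma D8_expand {R : Type*} [CommRing R] {k : ℕ} (h : ℤ → R) (A : Fin k → ℤ) (B : Fin k → ℕ)
    (s : MvPolynomial (Fin k) ℤ) (hs : alt8 B = s * alt8 (fun j : Fin k => (j : ℕ))) :
    D8 h A B = ∑ m ∈ s.support, s.coeff m •
      D8 h (fun i => A i + m i) (fun j : Fin k => (j : ℕ)) := by
  rw [← L8_alt, hs]
  conv_lhs => rw [s.as_sum]
  rw [Finset.sum_mul, map_sum]
  refine Finset.sum_congr rfl fun m _ => ?_
  rw [L8_mul, L8_alt]

lemma D8_perm {R : Type*} [CommRing R] {k : ℕ} (h : ℤ → R) (A : Fin k → ℤ) (B : Fin k → ℕ)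
    (σ : Equiv.Perm (Fin k)) : D8 h (A ∘ σ) B = ((Equiv.Perm.sign σ : ℤˣ) : ℤ) • D8 h A B := by
  rw [D8, D8, zsmul_eq_mul, ← Matrix.det_permute σ]
  rfl

lemma step8 {R : Type*} [CommRing R] {k : ℕ} (h : ℤ → R) (G : Submodule ℤ R)
    (A : Fin k → ℤ) (hA : StrictMono A) (B : Fin k → ℕ) (hB : StrictMono B)
    (M : Fin k → ℕ) (hM : ∀ i, B i = M i + i) (last : Fin k) (hlast : ∀ i, i ≤ last)
    (hG : D8 h A B ∈ G)
    (hrec : ∀ F : Fin k → ℤ, StrictMono F →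
      (∑ i : Fin k, ((i : ℕ) : ℤ) * F i < ∑ i : Fin k, ((i : ℕ) : ℤ) * (A i + M i)) →
      (∀ i, ∃ j, ∃ x : ℕ, x ≤ M last ∧ F i = A j + x) → D8 h F (fun j : Fin k => (j : ℕ)) ∈ G) :
    D8 h (fun i => A i + M i) (fun j : Fin k => (j : ℕ)) ∈ G := by
  classical
  obtain ⟨s, hs, htop, hsym⟩ := quot8 hB (ex8 M) (by simpa using hM)
  have hid : StrictMono (fun i : Fin k => (i : ℕ)) := fun i j h => h
  have hc1 := (htop _ hid).1
  -- bound on exponents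
  have hbd : ∀ m, s.coeff m ≠ 0 → ∀ i, m i ≤ M last := by
    intro m hm i
    have hm' := hsym (Equiv.swap i last) m hm
    set m' := ex8 (m ∘ Equiv.swap i last) with hm'def
    have hml : m' last = m i := by simp [hm'def]
    rw [← hml]
    set C := wt8 (fun i : Fin k => (i : ℕ)) (ex8 M) + 1 with hC
    let w : Fin k → ℕ := fun i => i + if i = last then C else 0
    have hw : StrictMono w := by
      intro a b hab
      have : a ≠ last := fun h => absurd (hlast b) (not_le.mpr (h ▸ hab))
      have hab' : (a : ℕ) < b := hab
      simp only [w, this, if_false]; omega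
    have hwt : ∀ q : Fin k →₀ ℕ, wt8 w q = wt8 (fun i : Fin k => (i : ℕ)) q + C * q last := by
      intro q; simp [wt8, w, add_mul, Finset.sum_add_distrib]
    have hle : wt8 w m' ≤ wt8 w (ex8 M) := by
      by_cases he : m' = ex8 M
      · rw [he]
      · exact ((htop w hw).2 m' hm' he).le
    rw [hwt, hwt, ex8_apply M] at hle
    by_contra hcon
    have : C * (M last + 1) ≤ C * m' last := Nat.mul_le_mul_left _ (by omega)
    rw [mul_add] at this
    omega
  rw [D8_expand h A B s hs] at hG
  have hmem : ex8 M ∈ s.support := by rw [MvPolynomial.mem_support_iff, hc1]; simp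
  rw [← Finset.add_sum_erase _ _ hmem, hc1, one_smul] at hG
  refine (Submodule.add_mem_iff_left G ?_).mp hG
  refine Submodule.sum_mem _ fun m hm => Submodule.smul_mem _ _ ?_
  rw [Finset.mem_erase, MvPolynomial.mem_support_iff] at hm
  obtain ⟨hne, hm⟩ := hm
  by_cases hinj : Function.Injective (fun i => A i + (m i : ℤ))
  · set F0 : Fin k → ℤ := fun i => A i + (m i : ℤ) with hF0
    set σ := Tuple.sort F0
    have hmono : StrictMono (F0 ∘ σ) :=
      (Tuple.monotone_sort F0).strictMono_of_injective (hinj.comp σ.injective)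
    have hD := hrec (F0 ∘ σ) hmono ?_ ?_
    · rw [D8_perm] at hD
      rcases Int.units_eq_one_or (Equiv.Perm.sign σ) with h | h <;> rw [h] at hD <;>
        simpa using hD
    · simp only [hF0, Function.comp, mul_add, Finset.sum_add_distrib]
      have hm2 := hsym σ m hm
      have hwm : ex8 (m ∘ σ) ≠ ex8 M → (∑ i : Fin k, ((i : ℕ) : ℤ) * (m (σ i) : ℤ)) <
          ∑ i : Fin k, ((i : ℕ) : ℤ) * (M i : ℤ) := by
        intro he
        have := (htop _ hid).2 _ hm2 he
        simp only [wt8, ex8_apply, Function.comp] at this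
        exact_mod_cast this
      by_cases hσ : σ = 1
      · rw [hσ] at hwm ⊢
        have := hwm (by
          intro h; apply hne; rw [← h]; ext i; simp)
        simpa using this
      · have h1 := perm8_lt (α := ℤ) (w := fun i : Fin k => ((i : ℕ) : ℤ)) (B := A)
          (fun i j h => Int.ofNat_lt.mpr h) hA σ hσ
        have h2 : (∑ i : Fin k, ((i : ℕ) : ℤ) * (m (σ i) : ℤ)) ≤
          ∑ i : Fin k, ((i : ℕ) : ℤ) * (M i : ℤ) := by
          by_cases he : ex8 (m ∘ σ) = ex8 M
          · apply le_of_eq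
            refine Finset.sum_congr rfl fun i _ => ?_
            have := DFunLike.congr_fun he i
            simp only [ex8_apply, Function.comp] at this
            rw [this]
          · exact (hwm he).le
        linarith
    · intro i
      exact ⟨σ i, m (σ i), hbd m hm _, rfl⟩
  · have : D8 h (fun i => A i + (m i : ℤ)) (fun j : Fin k => (j : ℕ)) = 0 := by
      rw [Function.Injective] at hinj
      push Not at hinj
      obtain ⟨a, b, hab, hne⟩ := hinj
      rw [D8]
      refine Matrix.det_zero_of_row_eq hne ?_
      funext j
      simp only [Matrix.of_apply]
      rw [hab]
    rw [this]; exact G.zero_mem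

lemma skew8_eq (n k : ℕ) (lam mu : Fin k → ℕ) (u : ℕ) (A : Fin k → ℤ) (B : Fin k → ℕ)
    (hA : ∀ i, A i = (lam (Fin.rev i) : ℤ) - k + i - u)
    (hB : ∀ j, (B j : ℤ) = (j : ℕ) - (mu j : ℤ) + u) :
    D8 (fun z => Hf n (z + 1)) A B =
      ((Equiv.Perm.sign (Fin.revPerm : Equiv.Perm (Fin k)) : ℤˣ) : ℤ) • skewSchur n k lam mu := by
  rw [skewSchur, zsmul_eq_mul, ← Matrix.det_permute, D8]
  congr 1
  ext1 i j
  simp only [Matrix.of_apply, Matrix.submatrix_apply, Fin.revPerm_apply, id]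
  congr 1
  rw [hA, hB, Fin.val_rev]
  have := i.2
  push_cast [Nat.cast_sub (show (i : ℕ) + 1 ≤ k by omega)]
  ring

lemma unit_smul8 {R : Type*} [AddCommGroup R] (G : Submodule ℤ R) (u : ℤˣ) (x : R) :
    (u : ℤ) • x ∈ G ↔ x ∈ G := by
  rcases Int.units_eq_one_or u with h | h <;> rw [h] <;> simp

lemma gap8 {k : ℕ} {E : Fin k → ℤ} (hE : StrictMono E) {i j : Fin k} (hij : i ≤ j) :
    E i + (j : ℕ) ≤ E j + (i : ℕ) := by
  have : ∀ d : ℕ, ∀ j : Fin k, (j : ℕ) = i + d → E i + (j : ℕ) ≤ E j + (i : ℕ) := by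
    intro d
    induction d with
    | zero => intro j hj; have : j = i := Fin.ext (by omega)
              rw [this]
    | succ d ih =>
      intro j hj
      have := j.2
      have h1 := ih ⟨i + d, by omega⟩ rfl
      have h2 : E ⟨i + d, by omega⟩ < E j := hE (by rw [Fin.lt_def]; simp; omega)
      simp only at h1
      push_cast at h1
      omega
  exact this (j - i) j (by have : (i : ℕ) ≤ j := hij; omega)

lemma main8 (n k c : ℕ) (hk : 1 ≤ k) (hkc : k ≤ c) (hcn : 2 * c ≤ n)
    (G : Submodule ℤ (MvPolynomial ℕ ℤ))
    (z l : Fin k) (hz0 : (z : ℕ) = 0) (hl0 : (l : ℕ) = k - 1)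
    (hG : ∀ lam mu : Fin k → ℕ, Antitone lam → Antitone mu → (∀ i, mu i ≤ lam i) →
          (lam z : ℤ) ≤ (n : ℤ) - k + 1 →
          (k : ℤ) ≤ (lam l : ℤ) →
          (mu z : ℤ) ≤ (c : ℤ) - k →
          (∀ i, (k : ℤ) ≤ (lam i : ℤ) - (mu i : ℤ)) →
          (lam z : ℤ) - (lam l : ℤ) ≤ (n : ℤ) - c - k + 1 →
          skewSchur n k lam mu ∈ G) :
    ∀ (N : ℕ) (E : Fin k → ℤ), StrictMono E → (∀ i, 0 ≤ E i) → (∀ i, E i ≤ (n : ℤ) - k) →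
      ∑ i : Fin k, ((i : ℕ) : ℤ) * E i < N →
      D8 (fun z => Hf n (z + 1)) E (fun j : Fin k => (j : ℕ)) ∈ G := by
  intro N
  induction N with
  | zero =>
    intro E _ h0 _ hs
    exact absurd (Finset.sum_nonneg (fun (i : Fin k) (_ : i ∈ Finset.univ) =>
      mul_nonneg (Int.natCast_nonneg (i : ℕ)) (h0 i))) (not_le.mpr (by simpa using hs))
  | succ N ih =>
    intro E hE h0 h1 hs
    have hzl : Fin.rev z = l := by ext; rw [Fin.val_rev, hz0, hl0]
    have hlz : Fin.rev l = z := by rw [← hzl, Fin.rev_rev]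
    have hl : ∀ i : Fin k, i ≤ l := fun i => by rw [Fin.le_def]; omega
    have hz : ∀ i : Fin k, z ≤ i := fun i => by rw [Fin.le_def]; omega
    -- ν in reversed order: e i = ν (rev i)
    let e : Fin k → ℤ := fun i => E i + k - (i : ℕ)
    have he : Monotone e := by
      intro i j hij
      have := gap8 hE hij
      simp only [e]; omega
    have hek : ∀ i, (k : ℤ) ≤ e i := by
      intro i
      refine le_trans ?_ (he (hz i))
      have := h0 z
      simp only [e]; omega
    have hel : e l ≤ (n : ℤ) - k + 1 := by
      have := h1 l
      simp only [e]; omega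
    let t : ℤ := e l - ((n : ℤ) - c - k + 1)
    have htl : t ≤ e l := by simp only [t]; omega
    have htz : t - e z ≤ (c : ℤ) - k := by have := hek z; simp only [t]; omega
    let lam : Fin k → ℕ := fun i => (max (e (Fin.rev i)) t).toNat
    let mu : Fin k → ℕ := fun i => (max 0 (t - e i)).toNat
    have hlam : ∀ i, (lam i : ℤ) = max (e (Fin.rev i)) t := by
      intro i; have := hek (Fin.rev i)
      simp only [lam]; rw [Int.toNat_of_nonneg]; omega
    have hmu : ∀ i, (mu i : ℤ) = max 0 (t - e i) := by
      intro i; simp only [mu]; rw [Int.toNat_of_nonneg]; omega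
    have hlamA : Antitone lam := by
      intro i j hij
      have := he (Fin.rev_le_rev.mpr hij)
      have h1 := hlam i; have h2 := hlam j
      omega
    have hmuA : Antitone mu := by
      intro i j hij
      have := he hij
      have h1 := hmu i; have h2 := hmu j
      omega
    have hdiff : ∀ i, (k : ℤ) ≤ (lam i : ℤ) - (mu i : ℤ) := by
      intro i
      rw [hlam, hmu]
      have := hek (Fin.rev i); have := hek i
      omega
    have hmem := hG lam mu hlamA hmuA (fun i => by have := hdiff i; omega)
      (by change (lam z : ℤ) ≤ _; rw [hlam, hzl]; omega)
      (by change _ ≤ (lam l : ℤ); rw [hlam, hlz]; have := hek z; omega)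
      (by change (mu z : ℤ) ≤ _; rw [hmu]; omega)
      hdiff
      (by change (lam z : ℤ) - (lam l : ℤ) ≤ _; rw [hlam, hlam, hzl, hlz]; simp only [t] at *; omega)
    let M : Fin k → ℕ := fun i => mu z - mu i
    have hMz : ∀ i, (M i : ℤ) = (mu z : ℤ) - mu i := fun i => by
      have := hmuA (hz i); simp only [M]; omega
    let A : Fin k → ℤ := fun i => (lam (Fin.rev i) : ℤ) - k + (i : ℕ) - mu z
    let B : Fin k → ℕ := fun i => M i + i
    have hAE : ∀ i, A i + M i = E i := by
      intro i
      rw [hMz]; simp only [A]; rw [hlam, Fin.rev_rev, hmu i]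
      simp only [e]; omega
    have hAE' : (fun i => A i + (M i : ℤ)) = E := funext hAE
    have hmul : mu l = 0 := by have := hmu l; omega
    have hMl : M l = mu z := by simp only [M, hmul]; omega
    have hAm : StrictMono A := by
      intro i j hij
      have h2 := hlamA (Fin.rev_le_rev.mpr hij.le)
      have h3 : (i : ℕ) < j := hij
      simp only [A]; omega
    have hBm : StrictMono B := by
      intro i j hij
      have h2 := hmuA hij.le
      have h3 : (i : ℕ) < j := hij
      simp only [B, M]; omega
    rw [← hAE']
    apply step8 (fun z => Hf n (z + 1)) G A hAm B hBm M (fun _ => rfl) l hl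
    · rw [skew8_eq n k lam mu (mu z) A B (fun _ => rfl) (fun j => by
        simp only [B]; push_cast; rw [hMz]; ring), unit_smul8]
      exact hmem
    · intro F hF hlt hb
      apply ih F hF
      · intro i
        obtain ⟨j, x, hx, hFi⟩ := hb i
        rw [hFi]
        have h2 := hAm.monotone (hz j)
        have h3 := hAE z
        have h4 := h0 z
        have h5 := hMz z
        omega
      · intro i
        obtain ⟨j, x, hx, hFi⟩ := hb i
        rw [hFi]
        have h2 := hAm.monotone (hl j)
        have h3 := hAE l
        have h4 := h1 l
        rw [hMl] at hx h3
        omega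
      · simp only [hAE] at hlt
        push_cast at hs
        omega

theorem stmt8 (n k c : ℕ) (hk : 1 ≤ k) (hkc : k ≤ c) (hcn : 2 * c ≤ n)
    (ν : Fin k → ℕ) (hν : Antitone ν)
    (hν1 : (ν ⟨0, by omega⟩ : ℤ) ≤ (n : ℤ) - k + 1)
    (hνk : (k : ℤ) ≤ (ν ⟨k - 1, by omega⟩ : ℤ)) :
    skewSchur n k ν (fun _ => 0) ∈
      Submodule.span ℤ {p : MvPolynomial ℕ ℤ |
        ∃ lam mu : Fin k → ℕ, Antitone lam ∧ Antitone mu ∧ (∀ i, mu i ≤ lam i) ∧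
          (lam ⟨0, by omega⟩ : ℤ) ≤ (n : ℤ) - k + 1 ∧
          (k : ℤ) ≤ (lam ⟨k - 1, by omega⟩ : ℤ) ∧
          (mu ⟨0, by omega⟩ : ℤ) ≤ (c : ℤ) - k ∧
          (∀ i, (k : ℤ) ≤ (lam i : ℤ) - (mu i : ℤ)) ∧
          (lam ⟨0, by omega⟩ : ℤ) - (lam ⟨k - 1, by omega⟩ : ℤ) ≤ (n : ℤ) - c - k + 1 ∧
          p = skewSchur n k lam mu} := by
  set G := Submodule.span ℤ {p : MvPolynomial ℕ ℤ |
        ∃ lam mu : Fin k → ℕ, Antitone lam ∧ Antitone mu ∧ (∀ i, mu i ≤ lam i) ∧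
          (lam ⟨0, by omega⟩ : ℤ) ≤ (n : ℤ) - k + 1 ∧
          (k : ℤ) ≤ (lam ⟨k - 1, by omega⟩ : ℤ) ∧
          (mu ⟨0, by omega⟩ : ℤ) ≤ (c : ℤ) - k ∧
          (∀ i, (k : ℤ) ≤ (lam i : ℤ) - (mu i : ℤ)) ∧
          (lam ⟨0, by omega⟩ : ℤ) - (lam ⟨k - 1, by omega⟩ : ℤ) ≤ (n : ℤ) - c - k + 1 ∧
          p = skewSchur n k lam mu} with hGdef
  let E : Fin k → ℤ := fun i => (ν (Fin.rev i) : ℤ) - k + (i : ℕ)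
  have hlo : ∀ i, k ≤ ν i := fun i => by
    have := hν (show i ≤ ⟨k - 1, by omega⟩ by rw [Fin.le_def]; simp; omega)
    omega
  have hhi : ∀ i, (ν i : ℤ) ≤ (n : ℤ) - k + 1 := fun i => by
    have := hν (show (⟨0, by omega⟩ : Fin k) ≤ i by rw [Fin.le_def]; simp)
    omega
  have hmain := main8 n k c hk hkc hcn G ⟨0, by omega⟩ ⟨k - 1, by omega⟩ rfl rfl (fun lam mu h1 h2 h3 h4 h5 h6 h7 h8 =>
    Submodule.subset_span ⟨lam, mu, h1, h2, h3, h4, h5, h6, h7, h8, rfl⟩)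
    ((∑ i : Fin k, ((i : ℕ) : ℤ) * E i).toNat + 1) E ?_ ?_ ?_ ?_
  · rw [skew8_eq n k ν (fun _ => 0) 0 E _ (fun i => by simp [E]) (fun j => by simp),
      unit_smul8] at hmain
    exact hmain
  · intro i j hij
    have h2 := hν (Fin.rev_le_rev.mpr hij.le)
    have h3 : (i : ℕ) < j := hij
    simp only [E]; omega
  · intro i; have := hlo (Fin.rev i); simp only [E]; omega
  · intro i; have := hhi (Fin.rev i); have := i.2; simp only [E]; omega
  · push_cast
    have := Int.self_le_toNat (∑ i : Fin k, ((i : ℕ) : ℤ) * E i)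
    omega
end

section
/- For positive integers a, b, c, set A = a+b, B = a+c, C = b+c, m = a+b+c-2, and let U_m : R_m → R_{m+1} be multiplication by x+y+z on R = ℤ[x,y,z]/(x^A,y^B,z^C) in the monomial bases. Then the permanent of the square matrix U_m equals the number of plane partitions fitting in an a×b×c box. -/
open Matrix

/-- Monomials `x^i y^j z^k` of degree `s` nonzero in `ℤ[x,y,z]/(x^A,y^B,z^C)`. -/
def Mon (A B C s : ℕ) : Type :=
  {v : Fin A × Fin B × Fin C // (v.1 : ℕ) + (v.2.1 : ℕ) + (v.2.2 : ℕ) = s}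

instance (A B C s : ℕ) : Fintype (Mon A B C s) := by unfold Mon; infer_instance
instance (A B C s : ℕ) : DecidableEq (Mon A B C s) := by unfold Mon; infer_instance

/-- The matrix of multiplication by `x+y+z` in the monomial bases. -/
def Umat (A B C r : ℕ) : Matrix (Mon A B C (r+1)) (Mon A B C r) ℤ :=
  Matrix.of fun w v =>
    if (v.1.1 : ℕ) ≤ (w.1.1 : ℕ) ∧ (v.1.2.1 : ℕ) ≤ (w.1.2.1 : ℕ) ∧
        (v.1.2.2 : ℕ) ≤ (w.1.2.2 : ℕ) then (1 : ℤ) else 0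

/-- The number of plane partitions fitting in an `a × b × c` box: weakly decreasing
arrays with at most `a` rows, `b` columns, entries at most `c`. -/
def PPcount (a b c : ℕ) : ℕ :=
  Fintype.card {p : Fin a → Fin b → Fin (c + 1) //
    ∀ i i' j j', i ≤ i' → j ≤ j' → (p i' j' : ℕ) ≤ (p i j : ℕ)}

/-- The permanent of the (square) middle multiplication matrix `U_m`, as a sum over
bijections between the monomial bases. -/
noncomputable def permU (a b c : ℕ) : ℤ :=
  ∑ σ : Mon (a+b) (a+c) (b+c) (a+b+c-2) ≃ Mon (a+b) (a+c) (b+c) (a+b+c-2+1),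
    ∏ v, Umat (a+b) (a+c) (b+c) (a+b+c-2) (σ v) v

open Finset in
lemma cnt_iff (P : ℕ → Prop) [DecidablePred P] (n : ℕ)
    (h : ∀ k, k + 1 < n → P (k + 1) → P k) (k : ℕ) (hk : k < n) :
    k < ((range n).filter P).card ↔ P k := by
  have mono : ∀ d k, k + d < n → P (k + d) → P k := by
    intro d
    induction d with
    | zero => intro k _ h; exact h
    | succ d ih => intro k h1 h2; exact ih k (by omega) (h (k + d) (by omega) h2)
  constructor
  · intro hlt
    by_contra hP
    have hsub : (range n).filter P ⊆ range k := by
      intro t ht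
      simp only [mem_filter, mem_range] at ht ⊢
      by_contra hge
      apply hP
      apply mono (t - k) k
      · omega
      · rw [show k + (t - k) = t by omega]; exact ht.2
    have := card_le_card hsub
    simp at this
    omega
  · intro hP
    have hsub : range (k + 1) ⊆ (range n).filter P := by
      intro t ht
      simp only [mem_filter, mem_range] at ht ⊢
      refine ⟨by omega, mono (k - t) t (by omega) ?_⟩
      rw [show t + (k - t) = k by omega]; exact hP
    have := card_le_card hsub
    simp at this
    omega

/-- Local description of a matching: `x i j`, `y i j`, `z i j` tell through which edge the
monomial of degree `m+1` with first exponents `i, j` is matched. -/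
structure Tl (a b c : ℕ) (x y z : ℕ → ℕ → ℕ) : Prop where
  hw : ∀ i j, i < a + b → j < a + c → i + j + 1 ≤ a + b + c → a ≤ i + j →
    x i j + y i j + z i j = 1
  hv : ∀ i j, i < a + b → j < a + c → i + j + 2 ≤ a + b + c → a ≤ i + j + 1 →
    x (i + 1) j + y i (j + 1) + z i j = 1
  hx : ∀ i j, x i j ≠ 0 → 1 ≤ i ∧ i < a + b ∧ j < a + c ∧ i + j + 1 ≤ a + b + c ∧ a ≤ i + j
  hy : ∀ i j, y i j ≠ 0 → 1 ≤ j ∧ i < a + b ∧ j < a + c ∧ i + j + 1 ≤ a + b + c ∧ a ≤ i + j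
  hz : ∀ i j, z i j ≠ 0 → i < a + b ∧ j < a + c ∧ i + j + 2 ≤ a + b + c ∧ a ≤ i + j

/-- Height function. -/
def HM (a : ℕ) (y : ℕ → ℕ → ℕ) : ℕ → ℕ → ℕ
  | 0, j => a - j
  | i + 1, j => HM a y i j + y i j

namespace Tl
variable {a b c : ℕ} {x y z : ℕ → ℕ → ℕ}

lemma yle (T : Tl a b c x y z) (i j : ℕ) : y i j ≤ 1 := by
  by_contra h
  have h1 := T.hy i j (by omega)
  have h2 := T.hw i j (by omega) (by omega) (by omega) (by omega)
  omega

lemma low (T : Tl a b c x y z) (I j : ℕ) (h : I + j ≤ a) : HM a y I j = a - j := by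
  induction I with
  | zero => rfl
  | succ i ih =>
    have h1 := ih (by omega)
    have h2 : y i j = 0 := by
      by_contra h0
      have := T.hy i j h0
      omega
    simp only [HM]; omega

lemma one (T : Tl a b c x y z) (i j : ℕ) (h1 : i < a + b) (h2 : j < a + c)
    (h3 : i + j + 2 ≤ a + b + c) (h4 : a ≤ i + j + 1) :
    HM a y (i + 1) j = HM a y (i + 1) (j + 1) + x (i + 1) j := by
  induction i with
  | zero =>
    have hv := T.hv 0 j h1 h2 h3 h4
    have e0 : HM a y 0 j = a - j := rfl
    have e1 : HM a y 0 (j + 1) = a - (j + 1) := rfl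
    simp only [HM] at *
    by_cases h : a ≤ 0 + j
    · have hw := T.hw 0 j h1 h2 (by omega) h
      have hx : x 0 j = 0 := by
        by_contra h0
        have := T.hx 0 j h0
        omega
      omega
    · have hy : y 0 j = 0 := by
        by_contra h0
        have := T.hy 0 j h0
        omega
      have hz : z 0 j = 0 := by
        by_contra h0
        have := T.hz 0 j h0
        omega
      omega
  | succ i ih =>
    have hv := T.hv (i + 1) j h1 h2 h3 h4
    show HM a y (i + 1) j + y (i + 1) j = HM a y (i + 1) (j + 1) + y (i + 1) (j + 1) + _
    by_cases h : a ≤ i + 1 + j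
    · have hw := T.hw (i + 1) j h1 h2 (by omega) h
      have := ih (by omega) (by omega) (by omega)
      omega
    · have hy : y (i + 1) j = 0 := by
        by_contra h0
        have := T.hy _ j h0
        omega
      have hz : z (i + 1) j = 0 := by
        by_contra h0
        have := T.hz _ j h0
        omega
      have e1 := T.low (i + 1) j (by omega)
      have e2 := T.low (i + 1) (j + 1) (by omega)
      omega

lemma mono (_T : Tl a b c x y z) (I d j : ℕ) : HM a y I j ≤ HM a y (I + d) j := by
  induction d with
  | zero => simp
  | succ d ih =>
    have : HM a y (I + (d + 1)) j = HM a y (I + d) j + y (I + d) j := rfl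
    omega

lemma lip (T : Tl a b c x y z) (I d j : ℕ) : HM a y (I + d) j ≤ HM a y I j + d := by
  induction d with
  | zero => simp
  | succ d ih =>
    have : HM a y (I + (d + 1)) j = HM a y (I + d) j + y (I + d) j := rfl
    have := T.yle (I + d) j
    omega

lemma leI (T : Tl a b c x y z) (I j : ℕ) : HM a y I j ≤ max I (a - j) := by
  induction I with
  | zero => simp [HM]
  | succ i ih =>
    have : HM a y (i + 1) j = HM a y i j + y i j := rfl
    have h1 := T.yle i j
    by_cases h0 : y i j = 0
    · omega
    · have := T.hy _ _ h0
      omega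

lemma top (T : Tl a b c x y z) (I : ℕ) (hI : I ≤ b) : HM a y I (a + c) = 0 := by
  induction I with
  | zero => simp [HM]
  | succ i ih =>
    have : HM a y (i + 1) (a + c) = HM a y i (a + c) + y i (a + c) := rfl
    by_cases h0 : y i (a + c) = 0
    · have := ih (by omega); omega
    · have := T.hy _ _ h0
      omega

lemma diag (T : Tl a b c x y z) (hb : 1 ≤ b) (d : ℕ) (hd : d ≤ a) :
    HM a y (b + d) (a + c - d) = d := by
  induction d with
  | zero => exact T.top b le_rfl
  | succ d ih =>
    have h := ih (by omega)
    have e : HM a y (b + (d + 1)) (a + c - (d + 1))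
      = HM a y (b + d) (a + c - (d + 1)) + y (b + d) (a + c - (d + 1)) := rfl
    have h1 := T.one (b + d - 1) (a + c - (d + 1)) (by omega) (by omega) (by omega) (by omega)
    rw [show b + d - 1 + 1 = b + d by omega, show a + c - (d + 1) + 1 = a + c - d by omega] at h1
    have hw := T.hw (b + d) (a + c - (d + 1)) (by omega) (by omega) (by omega) (by omega)
    have hz : z (b + d) (a + c - (d + 1)) = 0 := by
      by_contra h0
      have := T.hz _ _ h0
      omega
    omega

lemma right (T : Tl a b c x y z) (hb : 1 ≤ b) (d : ℕ) (hd : d ≤ c) :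
    HM a y (a + b) (c - d) = a := by
  induction d with
  | zero =>
    have := T.diag hb a le_rfl
    rwa [show b + a = a + b by omega, show a + c - a = c - 0 by omega] at this
  | succ d ih =>
    have h := ih (by omega)
    have h1 := T.one (a + b - 1) (c - (d + 1)) (by omega) (by omega) (by omega) (by omega)
    rw [show a + b - 1 + 1 = a + b by omega, show c - (d + 1) + 1 = c - d by omega] at h1
    have hx : x (a + b) (c - (d + 1)) = 0 := by
      by_contra h0
      have := T.hx _ _ h0
      omega
    omega

lemma bounds (T : Tl a b c x y z) (hb : 1 ≤ b) (I j : ℕ) (h1 : I ≤ a + b) (h2 : j ≤ a + c)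
    (h3 : I + j ≤ a + b + c) (h4 : a ≤ I + j) :
    HM a y I j ≤ I ∧ HM a y I j ≤ a ∧ HM a y I j + j ≤ a + c ∧ a ≤ HM a y I j + j ∧
      I ≤ HM a y I j + b := by
  have hI := T.leI I j
  have h0 := T.mono 0 I j
  rw [zero_add] at h0
  have e0 : HM a y 0 j = a - j := rfl
  by_cases hj : c ≤ j
  · have hd := T.diag hb (a + c - j) (by omega)
    rw [show a + c - (a + c - j) = j by omega] at hd
    have m1 := T.mono I (b + (a + c - j) - I) j
    have m2 := T.lip I (b + (a + c - j) - I) j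
    rw [show I + (b + (a + c - j) - I) = b + (a + c - j) by omega] at m1 m2
    omega
  · have hd := T.right hb (c - j) (by omega)
    rw [show c - (c - j) = j by omega] at hd
    have m1 := T.mono I (a + b - I) j
    have m2 := T.lip I (a + b - I) j
    rw [show I + (a + b - I) = a + b by omega] at m1 m2
    omega

lemma diff1 (T : Tl a b c x y z) (r s t : ℕ) (hr : r < a) (hs : s < b) (ht : t + 1 < c)
    (h : r < HM a y (r + b - s) (t + 1 + a - r)) : r < HM a y (r + b - s) (t + a - r) := by
  have := T.one (r + b - s - 1) (t + a - r) (by omega) (by omega) (by omega) (by omega)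
  rw [show r + b - s - 1 + 1 = r + b - s by omega,
    show t + a - r + 1 = t + 1 + a - r by omega] at this
  omega

lemma diff2 (T : Tl a b c x y z) (r s t : ℕ) (hr : r < a) (hs : s + 1 < b) (ht : t < c)
    (h : r < HM a y (r + b - (s + 1)) (t + a - r)) : r < HM a y (r + b - s) (t + a - r) := by
  have := T.mono (r + b - (s + 1)) 1 (t + a - r)
  rw [show r + b - (s + 1) + 1 = r + b - s by omega] at this
  omega

lemma diff3 (T : Tl a b c x y z) (r s t : ℕ) (hr : r + 1 < a) (hs : s < b) (ht : t < c)
    (h : r + 1 < HM a y (r + 1 + b - s) (t + a - (r + 1))) :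
    r < HM a y (r + b - s) (t + a - r) := by
  have h1 := T.one (r + b - s) (t + a - (r + 1)) (by omega) (by omega) (by omega) (by omega)
  have hv := T.hv (r + b - s) (t + a - (r + 1)) (by omega) (by omega) (by omega) (by omega)
  rw [show t + a - (r + 1) + 1 = t + a - r by omega] at h1 hv
  have h2 : HM a y (r + b - s + 1) (t + a - r)
    = HM a y (r + b - s) (t + a - r) + y (r + b - s) (t + a - r) := rfl
  rw [show r + 1 + b - s = r + b - s + 1 by omega] at h
  omega

open Finset in
/-- the plane partition attached to a matching -/
def pp (a b c : ℕ) (y : ℕ → ℕ → ℕ) (r s : ℕ) : ℕ :=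
  ((range c).filter (fun t => r < HM a y (r + b - s) (t + a - r))).card

lemma pp_le (r s : ℕ) : pp a b c y r s ≤ c := by
  unfold pp
  refine (Finset.card_filter_le _ _).trans ?_
  simp

lemma pp_iff (T : Tl a b c x y z) (r s t : ℕ) (hr : r < a) (hs : s < b) (ht : t < c) :
    t < pp a b c y r s ↔ r < HM a y (r + b - s) (t + a - r) :=
  cnt_iff (fun t => r < HM a y (r + b - s) (t + a - r)) c
    (fun k hk h => T.diff1 r s k hr hs hk h) t ht

lemma pp_anti1 (T : Tl a b c x y z) (r s : ℕ) (hr : r + 1 < a) (hs : s < b) :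
    pp a b c y (r + 1) s ≤ pp a b c y r s := by
  apply Finset.card_le_card
  intro t ht
  simp only [Finset.mem_filter, Finset.mem_range] at ht ⊢
  exact ⟨ht.1, T.diff3 r s t hr hs ht.1 ht.2⟩

lemma pp_anti2 (T : Tl a b c x y z) (r s : ℕ) (hr : r < a) (hs : s + 1 < b) :
    pp a b c y r (s + 1) ≤ pp a b c y r s := by
  apply Finset.card_le_card
  intro t ht
  simp only [Finset.mem_filter, Finset.mem_range] at ht ⊢
  exact ⟨ht.1, T.diff2 r s t hr hs ht.1 ht.2⟩

lemma HM_le {x' y' z' : ℕ → ℕ → ℕ} (T : Tl a b c x y z) (T' : Tl a b c x' y' z') (hb : 1 ≤ b)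
    (h : ∀ r s, r < a → s < b → pp a b c y r s = pp a b c y' r s)
    (I j : ℕ) (h1 : I ≤ a + b) (h2 : j ≤ a + c)
    (h3 : I + j ≤ a + b + c) (h4 : a ≤ I + j) : HM a y' I j ≤ HM a y I j := by
  by_contra hlt
  have B := T.bounds hb I j h1 h2 h3 h4
  have B' := T'.bounds hb I j h1 h2 h3 h4
  obtain ⟨r, hr⟩ : ∃ r, HM a y I j = r := ⟨_, rfl⟩
  have hs := h r (r + b - I) (by omega) (by omega)
  have e := T.pp_iff r (r + b - I) (j + r - a) (by omega) (by omega) (by omega)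
  have e' := T'.pp_iff r (r + b - I) (j + r - a) (by omega) (by omega) (by omega)
  rw [show r + b - (r + b - I) = I by omega, show j + r - a + a - r = j by omega] at e e'
  omega

lemma HM_eq {x' y' z' : ℕ → ℕ → ℕ} (T : Tl a b c x y z) (T' : Tl a b c x' y' z') (hb : 1 ≤ b)
    (h : ∀ r s, r < a → s < b → pp a b c y r s = pp a b c y' r s)
    (I j : ℕ) (h1 : I ≤ a + b) (h2 : j ≤ a + c)
    (h3 : I + j ≤ a + b + c) (h4 : a ≤ I + j) : HM a y I j = HM a y' I j :=
  le_antisymm (T'.HM_le T hb (fun r s hr hs => (h r s hr hs).symm) I j h1 h2 h3 h4)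
    (T.HM_le T' hb h I j h1 h2 h3 h4)

lemma xy_eq {x' y' z' : ℕ → ℕ → ℕ} (T : Tl a b c x y z) (T' : Tl a b c x' y' z') (hb : 1 ≤ b)
    (h : ∀ r s, r < a → s < b → pp a b c y r s = pp a b c y' r s)
    (i j : ℕ) (h1 : i < a + b) (h2 : j < a + c) (h3 : i + j + 2 ≤ a + b + c)
    (h4 : a ≤ i + j + 1) : x (i + 1) j = x' (i + 1) j ∧ y i (j + 1) = y' i (j + 1) := by
  have e1 := T.HM_eq T' hb h (i + 1) j (by omega) (by omega) (by omega) (by omega)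
  have e2 := T.HM_eq T' hb h (i + 1) (j + 1) (by omega) (by omega) (by omega) (by omega)
  have e3 := T.HM_eq T' hb h i (j + 1) (by omega) (by omega) (by omega) (by omega)
  have o := T.one i j h1 h2 h3 h4
  have o' := T'.one i j h1 h2 h3 h4
  have s1 : HM a y (i + 1) (j + 1) = HM a y i (j + 1) + y i (j + 1) := rfl
  have s2 : HM a y' (i + 1) (j + 1) = HM a y' i (j + 1) + y' i (j + 1) := rfl
  omega

end Tl

/-! ### From matchings to local data -/

namespace Mon
variable {A B C s : ℕ}

lemma ext2 {v w : Mon A B C s} (h1 : (v.1.1 : ℕ) = w.1.1) (h2 : (v.1.2.1 : ℕ) = w.1.2.1) :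
    v = w := by
  have hv := v.2
  have hw := w.2
  apply Subtype.ext
  apply Prod.ext
  · exact Fin.ext h1
  · apply Prod.ext
    · exact Fin.ext h2
    · apply Fin.ext; omega

lemma exi (i j : ℕ) (h1 : i < A) (h2 : j < B) (h3 : i + j ≤ s) (h4 : s < C + (i + j)) :
    ∃ v : Mon A B C s, (v.1.1 : ℕ) = i ∧ (v.1.2.1 : ℕ) = j :=
  ⟨⟨(⟨i, h1⟩, ⟨j, h2⟩, ⟨s - i - j, by omega⟩), by simp; omega⟩, rfl, rfl⟩

end Mon

/-- the order relation behind `Umat` -/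
def Dv {A B C r : ℕ} (v : Mon A B C r) (w : Mon A B C (r + 1)) : Prop :=
  (v.1.1 : ℕ) ≤ (w.1.1 : ℕ) ∧ (v.1.2.1 : ℕ) ≤ (w.1.2.1 : ℕ) ∧ (v.1.2.2 : ℕ) ≤ (w.1.2.2 : ℕ)

section fromSigma
variable {A B C r : ℕ} (σ : Mon A B C r → Mon A B C (r + 1))

open Classical in
noncomputable def sx (i j : ℕ) : ℕ :=
  if ∃ v, (v.1.1 : ℕ) + 1 = i ∧ (v.1.2.1 : ℕ) = j ∧ ((σ v).1.1 : ℕ) = i ∧ ((σ v).1.2.1 : ℕ) = j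
    then 1 else 0

open Classical in
noncomputable def sy (i j : ℕ) : ℕ :=
  if ∃ v, (v.1.1 : ℕ) = i ∧ (v.1.2.1 : ℕ) + 1 = j ∧ ((σ v).1.1 : ℕ) = i ∧ ((σ v).1.2.1 : ℕ) = j
    then 1 else 0

open Classical in
noncomputable def sz (i j : ℕ) : ℕ :=
  if ∃ v, (v.1.1 : ℕ) = i ∧ (v.1.2.1 : ℕ) = j ∧ ((σ v).1.1 : ℕ) = i ∧ ((σ v).1.2.1 : ℕ) = j
    then 1 else 0

lemma sx_val (v : Mon A B C r) (hd : Dv v (σ v)) :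
    sx σ ((v.1.1 : ℕ) + 1) v.1.2.1 = ((σ v).1.1 : ℕ) - v.1.1 := by
  have e1 := v.2
  have e2 := (σ v).2
  obtain ⟨d1, d2, d3⟩ := hd
  unfold sx
  split_ifs with h
  · obtain ⟨u, h1, h2, h3, h4⟩ := h
    obtain rfl : u = v := Mon.ext2 (by omega) h2
    omega
  · by_contra h0
    exact h ⟨v, rfl, rfl, by omega, by omega⟩

lemma sy_val (v : Mon A B C r) (hd : Dv v (σ v)) :
    sy σ (v.1.1 : ℕ) ((v.1.2.1 : ℕ) + 1) = ((σ v).1.2.1 : ℕ) - v.1.2.1 := by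
  have e1 := v.2
  have e2 := (σ v).2
  obtain ⟨d1, d2, d3⟩ := hd
  unfold sy
  split_ifs with h
  · obtain ⟨u, h1, h2, h3, h4⟩ := h
    obtain rfl : u = v := Mon.ext2 (by omega) (by omega)
    omega
  · by_contra h0
    exact h ⟨v, rfl, rfl, by omega, by omega⟩

lemma sz_val (v : Mon A B C r) (hd : Dv v (σ v)) :
    sz σ (v.1.1 : ℕ) (v.1.2.1 : ℕ) = ((σ v).1.2.2 : ℕ) - v.1.2.2 := by
  have e1 := v.2
  have e2 := (σ v).2
  obtain ⟨d1, d2, d3⟩ := hd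
  unfold sz
  split_ifs with h
  · obtain ⟨u, h1, h2, h3, h4⟩ := h
    obtain rfl : u = v := Mon.ext2 (by omega) (by omega)
    omega
  · by_contra h0
    exact h ⟨v, rfl, rfl, by omega, by omega⟩

end fromSigma

lemma Tl_of {a b c : ℕ} (ha : 1 ≤ a) (hb : 1 ≤ b) (hc : 1 ≤ c)
    (σ : Mon (a+b) (a+c) (b+c) (a+b+c-2) ≃ Mon (a+b) (a+c) (b+c) (a+b+c-2+1))
    (hσ : ∀ v, Dv v (σ v)) : Tl a b c (sx σ) (sy σ) (sz σ) where
  hw := by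
    intro i j h1 h2 h3 h4
    obtain ⟨w, w1, w2⟩ := Mon.exi (A := a+b) (B := a+c) (C := b+c) (s := a+b+c-2+1) i j
      h1 h2 (by omega) (by omega)
    obtain ⟨v, rfl⟩ := σ.surjective w
    have e1 := v.2
    have e2 := (σ v).2
    obtain ⟨d1, d2, d3⟩ := hσ v
    have key : ∀ u, ((σ u).1.1 : ℕ) = i → ((σ u).1.2.1 : ℕ) = j → u = v := fun u a1 a2 =>
      σ.injective (Mon.ext2 (by omega) (by omega))
    have hx : sx σ i j = i - v.1.1 := by
      unfold sx
      split_ifs with h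
      · obtain ⟨u, h1, h2, h3, h4⟩ := h
        obtain rfl := key u h3 h4
        omega
      · by_contra h0
        exact h ⟨v, by omega, by omega, by omega, by omega⟩
    have hy : sy σ i j = j - v.1.2.1 := by
      unfold sy
      split_ifs with h
      · obtain ⟨u, h1, h2, h3, h4⟩ := h
        obtain rfl := key u h3 h4
        omega
      · by_contra h0
        exact h ⟨v, by omega, by omega, by omega, by omega⟩
    have hz : sz σ i j = ((σ v).1.2.2 : ℕ) - v.1.2.2 := by
      unfold sz
      split_ifs with h
      · obtain ⟨u, h1, h2, h3, h4⟩ := h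
        obtain rfl := key u h3 h4
        omega
      · by_contra h0
        exact h ⟨v, by omega, by omega, by omega, by omega⟩
    omega
  hv := by
    intro i j h1 h2 h3 h4
    obtain ⟨v, rfl, rfl⟩ := Mon.exi (A := a+b) (B := a+c) (C := b+c) (s := a+b+c-2) i j
      h1 h2 (by omega) (by omega)
    have e1 := v.2
    have e2 := (σ v).2
    have hx := sx_val σ v (hσ v)
    have hy := sy_val σ v (hσ v)
    have hz := sz_val σ v (hσ v)
    obtain ⟨d1, d2, d3⟩ := hσ v
    omega
  hx := by
    intro i j h
    unfold sx at h
    split_ifs at h with h'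
    · obtain ⟨v, h1, h2, h3, h4⟩ := h'
      have e2 := (σ v).2
      have f1 := (σ v).1.1.2
      have f2 := (σ v).1.2.1.2
      have f3 := (σ v).1.2.2.2
      omega
    · exact absurd rfl h
  hy := by
    intro i j h
    unfold sy at h
    split_ifs at h with h'
    · obtain ⟨v, h1, h2, h3, h4⟩ := h'
      have e2 := (σ v).2
      have f1 := (σ v).1.1.2
      have f2 := (σ v).1.2.1.2
      have f3 := (σ v).1.2.2.2
      omega
    · exact absurd rfl h
  hz := by
    intro i j h
    unfold sz at h
    split_ifs at h with h'
    · obtain ⟨v, h1, h2, h3, h4⟩ := h'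
      have e2 := (σ v).2
      have f1 := (σ v).1.1.2
      have f2 := (σ v).1.2.1.2
      have f3 := (σ v).1.2.2.2
      have e1 := v.2
      omega
    · exact absurd rfl h

/-! ### From plane partitions to matchings -/

/-- A plane partition as a function on all of `ℕ × ℕ`. -/
structure IsPP (a b c : ℕ) (q : ℕ → ℕ → ℕ) : Prop where
  le : ∀ r s, q r s ≤ c
  an1 : ∀ r s, r + 1 < a → s < b → q (r + 1) s ≤ q r s
  an2 : ∀ r s, r < a → s + 1 < b → q r (s + 1) ≤ q r s

/-- membership predicate -/
def EE (a b : ℕ) (q : ℕ → ℕ → ℕ) (I j r : ℕ) : Prop :=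
  r + b < I ∨ (r < I ∧ j + r < q r (r + b - I) + a)

instance (a b : ℕ) (q : ℕ → ℕ → ℕ) (I j : ℕ) : DecidablePred (EE a b q I j) := fun r => by
  unfold EE; infer_instance

open Finset in
/-- Height function of a plane partition. -/
noncomputable def HP (a b : ℕ) (q : ℕ → ℕ → ℕ) (I j : ℕ) : ℕ :=
  ((range a).filter (EE a b q I j)).card

namespace IsPP
variable {a b c : ℕ} {q : ℕ → ℕ → ℕ}

lemma HP_le (I j : ℕ) : HP a b q I j ≤ a := by
  unfold HP
  refine (Finset.card_filter_le _ _).trans ?_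
  simp

lemma HP_iff (Q : IsPP a b c q) (I j r : ℕ) (hr : r < a) :
    r < HP a b q I j ↔ EE a b q I j r := by
  unfold HP
  refine cnt_iff (EE a b q I j) a ?_ r hr
  intro k hk h
  unfold EE at *
  by_cases h0 : k + b < I
  · exact Or.inl h0
  rcases h with h | ⟨h1, h2⟩
  · omega
  · right
    refine ⟨by omega, ?_⟩
    have a1 := Q.an1 k (k + 1 + b - I) hk (by omega)
    have a2 := Q.an2 k (k + b - I) (by omega) (by omega)
    rw [show k + b - I + 1 = k + 1 + b - I by omega] at a2
    omega

/-- comparison principle -/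
lemma HP_mono (Q : IsPP a b c q) (I j I' j' d : ℕ)
    (h : ∀ r, r + d < a → EE a b q I j (r + d) → EE a b q I' j' r) :
    HP a b q I j ≤ HP a b q I' j' + d := by
  by_contra hlt
  have hl := HP_le (a := a) (b := b) (q := q) I j
  obtain ⟨r, hr⟩ : ∃ r, HP a b q I' j' = r := ⟨_, rfl⟩
  have h1 := (Q.HP_iff I j (r + d) (by omega)).1 (by omega)
  have h2 := (Q.HP_iff I' j' r (by omega)).2 (h r (by omega) h1)
  omega

lemma c1 (Q : IsPP a b c q) (I j : ℕ) : HP a b q I (j + 1) ≤ HP a b q I j := by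
  refine Q.HP_mono I (j + 1) I j 0 ?_
  intro r hr h
  unfold EE at *
  simp only [add_zero] at *
  omega

lemma c1' (Q : IsPP a b c q) (I j : ℕ) : HP a b q I j ≤ HP a b q I (j + 1) + 1 := by
  refine Q.HP_mono I j I (j + 1) 1 ?_
  intro r hr h
  unfold EE at *
  by_cases h0 : r + b < I
  · exact Or.inl h0
  rcases h with h | ⟨h1, h2⟩
  · omega
  · right
    refine ⟨by omega, ?_⟩
    have a1 := Q.an1 r (r + 1 + b - I) hr (by omega)
    have a2 := Q.an2 r (r + b - I) (by omega) (by omega)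
    rw [show r + b - I + 1 = r + 1 + b - I by omega] at a2
    omega

lemma c2 (Q : IsPP a b c q) (I j : ℕ) : HP a b q I j ≤ HP a b q (I + 1) j := by
  refine Q.HP_mono I j (I + 1) j 0 ?_
  intro r hr h
  unfold EE at *
  simp only [add_zero] at *
  by_cases h0 : r + b < I + 1
  · exact Or.inl h0
  rcases h with h | ⟨h1, h2⟩
  · omega
  · right
    refine ⟨by omega, ?_⟩
    have a2 := Q.an2 r (r + b - (I + 1)) (by omega) (by omega)
    rw [show r + b - (I + 1) + 1 = r + b - I by omega] at a2
    omega

lemma c3 (Q : IsPP a b c q) (I j : ℕ) : HP a b q (I + 1) j ≤ HP a b q I (j + 1) + 1 := by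
  refine Q.HP_mono (I + 1) j I (j + 1) 1 ?_
  intro r hr h
  unfold EE at *
  by_cases h0 : r + b < I
  · exact Or.inl h0
  rcases h with h | ⟨h1, h2⟩
  · omega
  · right
    refine ⟨by omega, ?_⟩
    have a1 := Q.an1 r (r + b - I) hr (by omega)
    rw [show r + 1 + b - (I + 1) = r + b - I by omega] at h2
    omega

lemma bR (Q : IsPP a b c q) (j : ℕ) : HP a b q (a + b) j = a := by
  have hl := HP_le (a := a) (b := b) (q := q) (a + b) j
  by_contra h
  have := (Q.HP_iff (a + b) j (HP a b q (a + b) j) (by omega)).2 (Or.inl (by omega))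
  omega

lemma bT (Q : IsPP a b c q) (I : ℕ) (hI : I ≤ b) : HP a b q I (a + c) = 0 := by
  have hl := HP_le (a := a) (b := b) (q := q) I (a + c)
  by_contra h
  have h1 := (Q.HP_iff I (a + c) 0 (by omega)).1 (by omega)
  unfold EE at h1
  have := Q.le 0 (0 + b - I)
  omega

lemma bL (Q : IsPP a b c q) (I j : ℕ) (hI : I + j = a) : HP a b q I j = I := by
  have hl := HP_le (a := a) (b := b) (q := q) I j
  by_contra h
  rcases Nat.lt_or_gt_of_ne h with h | h
  · have := (Q.HP_iff I j (HP a b q I j) (by omega)).2 (Or.inr ⟨h, by omega⟩)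
    omega
  · have h1 := (Q.HP_iff I j I (by omega)).1 h
    unfold EE at h1
    omega

lemma b0 (Q : IsPP a b c q) (j : ℕ) : HP a b q 0 j = 0 := by
  have hl := HP_le (a := a) (b := b) (q := q) 0 j
  by_contra h
  have h1 := (Q.HP_iff 0 j 0 (by omega)).1 (by omega)
  unfold EE at h1
  omega

/-- The defining relation between `q` and its matching. -/
def Spec {a b c r : ℕ} (q : ℕ → ℕ → ℕ) (v : Mon (a+b) (a+c) (b+c) r)
    (w : Mon (a+b) (a+c) (b+c) (r+1)) : Prop :=
  Dv v w ∧
  HP a b q ((v.1.1 : ℕ) + 1) v.1.2.1 + (v.1.1 : ℕ)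
    = HP a b q ((v.1.1 : ℕ) + 1) ((v.1.2.1 : ℕ) + 1) + (w.1.1 : ℕ) ∧
  HP a b q ((v.1.1 : ℕ) + 1) ((v.1.2.1 : ℕ) + 1) + (v.1.2.1 : ℕ)
    = HP a b q (v.1.1 : ℕ) ((v.1.2.1 : ℕ) + 1) + (w.1.2.1 : ℕ)

lemma exists_w (Q : IsPP a b c q) (ha : 1 ≤ a) (hb : 1 ≤ b) (hc : 1 ≤ c)
    (v : Mon (a+b) (a+c) (b+c) (a+b+c-2)) :
    ∃ w : Mon (a+b) (a+c) (b+c) (a+b+c-2+1), Spec q v w := by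
  obtain ⟨⟨⟨i, hi⟩, ⟨j, hj⟩, ⟨k, hk⟩⟩, hs⟩ := v
  simp only at hs
  have k1 := Q.c1 (i + 1) j
  have k1' := Q.c1' (i + 1) j
  have k2 := Q.c2 i (j + 1)
  have k3 := Q.c3 i j
  by_cases hX : HP a b q (i + 1) j = HP a b q (i + 1) (j + 1)
  · by_cases hY : HP a b q (i + 1) (j + 1) = HP a b q i (j + 1)
    · have : k + 1 < b + c := by
        by_contra hk'
        have l1 := Q.bL (i + 1) j (by omega)
        have l2 := Q.bL i (j + 1) (by omega)
        omega
      refine ⟨⟨(⟨i, hi⟩, ⟨j, hj⟩, ⟨k + 1, this⟩), ?_⟩, ?_, ?_, ?_⟩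
      · simp only; omega
      · simp [Dv]
      · simp only; omega
      · simp only; omega
    · have : j + 1 < a + c := by
        by_contra hj'
        have l1 := Q.bT (i + 1) (by omega)
        have l2 := Q.bT i (by omega)
        rw [show j + 1 = a + c by omega] at hY
        omega
      refine ⟨⟨(⟨i, hi⟩, ⟨j + 1, this⟩, ⟨k, hk⟩), ?_⟩, ?_, ?_, ?_⟩
      · simp only; omega
      · simp [Dv]
      · simp only; omega
      · simp only; omega
  · have : i + 1 < a + b := by
      by_contra hi'
      have l1 := Q.bR j
      have l2 := Q.bR (j + 1)
      rw [show i + 1 = a + b by omega] at hX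
      omega
    refine ⟨⟨(⟨i + 1, this⟩, ⟨j, hj⟩, ⟨k, hk⟩), ?_⟩, ?_, ?_, ?_⟩
    · simp only; omega
    · simp [Dv]
    · simp only; omega
    · simp only; omega

lemma spec_inj (Q : IsPP a b c q) {r : ℕ}
    (v v' : Mon (a+b) (a+c) (b+c) r) (w : Mon (a+b) (a+c) (b+c) (r+1))
    (h : Spec q v w) (h' : Spec q v' w) : v = v' := by
  obtain ⟨⟨⟨i, hi⟩, ⟨j, hj⟩, ⟨k, hk⟩⟩, hs⟩ := v
  obtain ⟨⟨⟨i', hi'⟩, ⟨j', hj'⟩, ⟨k', hk'⟩⟩, hs'⟩ := v'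
  obtain ⟨⟨⟨I, hI⟩, ⟨J, hJ⟩, ⟨K, hK⟩⟩, hS⟩ := w
  obtain ⟨⟨d1, d2, d3⟩, h2, h3⟩ := h
  obtain ⟨⟨d1', d2', d3'⟩, h2', h3'⟩ := h'
  simp only at d1 d2 d3 d1' d2' d3' h2 h3 h2' h3'
  have g1 : i + j + k = r := hs
  have g2 : i' + j' + k' = r := hs'
  have g3 : I + J + K = r + 1 := hS
  have k1 := Q.c1 I J
  have k2 := Q.c2 I J
  have k3 := Q.c3 I J
  have t : (I = i + 1 ∧ J = j) ∨ (I = i ∧ J = j + 1) ∨ (I = i ∧ J = j) := by omega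
  have t' : (I = i' + 1 ∧ J = j') ∨ (I = i' ∧ J = j' + 1) ∨ (I = i' ∧ J = j') := by omega
  have : i = i' ∧ j = j' := by
    rcases t with ⟨rfl, rfl⟩ | ⟨rfl, rfl⟩ | ⟨rfl, rfl⟩ <;>
    rcases t' with ⟨e1, e2⟩ | ⟨e1, e2⟩ | ⟨e1, e2⟩ <;>
    first
    | (constructor <;> omega)
    | (exfalso; subst e1; subst e2; omega)
    | (exfalso; subst e1; omega)
    | (exfalso; subst e2; omega)
    | (exfalso; omega)
  exact Mon.ext2 this.1 this.2

end IsPP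

lemma card_Mon (a b c : ℕ) (ha : 1 ≤ a) (hb : 1 ≤ b) (hc : 1 ≤ c) :
    Fintype.card (Mon (a+b) (a+c) (b+c) (a+b+c-2))
      = Fintype.card (Mon (a+b) (a+c) (b+c) (a+b+c-2+1)) := by
  apply Fintype.card_congr
  refine ⟨fun v => ⟨(v.1.1.rev, v.1.2.1.rev, v.1.2.2.rev), ?_⟩,
    fun v => ⟨(v.1.1.rev, v.1.2.1.rev, v.1.2.2.rev), ?_⟩, ?_, ?_⟩
  · have := v.2
    have f1 := v.1.1.2
    have f2 := v.1.2.1.2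
    have f3 := v.1.2.2.2
    simp only [Fin.val_rev]
    omega
  · have := v.2
    have f1 := v.1.1.2
    have f2 := v.1.2.1.2
    have f3 := v.1.2.2.2
    simp only [Fin.val_rev]
    omega
  · intro v
    apply Subtype.ext
    simp
  · intro v
    apply Subtype.ext
    simp

lemma exists_sigma {a b c : ℕ} {q : ℕ → ℕ → ℕ} (Q : IsPP a b c q)
    (ha : 1 ≤ a) (hb : 1 ≤ b) (hc : 1 ≤ c) :
    ∃ σ : {σ : Mon (a+b) (a+c) (b+c) (a+b+c-2) ≃ Mon (a+b) (a+c) (b+c) (a+b+c-2+1) //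
      ∀ v, Dv v (σ v)}, ∀ v, IsPP.Spec q v (σ.1 v) := by
  choose f hf using Q.exists_w ha hb hc
  have hinj : Function.Injective f := by
    intro v v' h
    exact Q.spec_inj v v' (f v) (hf v) (h ▸ hf v')
  have hbij : Function.Bijective f :=
    (Fintype.bijective_iff_injective_and_card f).2 ⟨hinj, card_Mon a b c ha hb hc⟩
  exact ⟨⟨Equiv.ofBijective f hbij, fun v => (hf v).1⟩, hf⟩

lemma HP_eq {a b c : ℕ} {q q' : ℕ → ℕ → ℕ} (Q : IsPP a b c q) (Q' : IsPP a b c q')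
    (f : Mon (a+b) (a+c) (b+c) (a+b+c-2) → Mon (a+b) (a+c) (b+c) (a+b+c-2+1))
    (h : ∀ v, IsPP.Spec q v (f v)) (h' : ∀ v, IsPP.Spec q' v (f v))
    (I j : ℕ) (h1 : I ≤ a + b) (h2 : j < a + c)
    (h3 : I + (j + 1) ≤ a + b + c) (h4 : a ≤ I + (j + 1)) :
    HP a b q I (j + 1) = HP a b q' I (j + 1) := by
  induction I with
  | zero => rw [Q.b0, Q'.b0]
  | succ i ih =>
    by_cases he : i + 1 + (j + 1) = a
    · rw [Q.bL _ _ he, Q'.bL _ _ he]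
    · have hi := ih (by omega) (by omega) (by omega)
      obtain ⟨v, rfl, rfl⟩ := Mon.exi (A := a+b) (B := a+c) (C := b+c) (s := a+b+c-2) i j
        (by omega) h2 (by omega) (by omega)
      have e := (h v).2.2
      have e' := (h' v).2.2
      omega

lemma q_le {a b c : ℕ} {q q' : ℕ → ℕ → ℕ} (Q : IsPP a b c q) (Q' : IsPP a b c q')
    (f : Mon (a+b) (a+c) (b+c) (a+b+c-2) → Mon (a+b) (a+c) (b+c) (a+b+c-2+1))
    (h : ∀ v, IsPP.Spec q v (f v)) (h' : ∀ v, IsPP.Spec q' v (f v))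
    (r s : ℕ) (hr : r < a) (hs : s < b) : q' r s ≤ q r s := by
  by_contra hlt
  have l := Q.le r s
  have l' := Q'.le r s
  have e := HP_eq Q Q' f h h' (r + b - s) (q r s + a - r - 1) (by omega) (by omega) (by omega)
    (by omega)
  have i1 := Q.HP_iff (r + b - s) (q r s + a - r - 1 + 1) r hr
  have i2 := Q'.HP_iff (r + b - s) (q r s + a - r - 1 + 1) r hr
  unfold EE at i1 i2
  rw [show r + b - (r + b - s) = s by omega] at i1 i2
  omega

/-- extension of an array to `ℕ × ℕ` -/
def extq {a b c : ℕ} (p : Fin a → Fin b → Fin (c + 1)) (r s : ℕ) : ℕ :=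
  if h : r < a ∧ s < b then p ⟨r, h.1⟩ ⟨s, h.2⟩ else 0

lemma extq_isPP {a b c : ℕ} (p : Fin a → Fin b → Fin (c + 1))
    (hp : ∀ i i' j j', i ≤ i' → j ≤ j' → (p i' j' : ℕ) ≤ (p i j : ℕ)) :
    IsPP a b c (extq p) where
  le := by
    intro r s
    unfold extq
    split_ifs
    · omega
    · omega
  an1 := by
    intro r s hr hs
    unfold extq
    rw [dif_pos ⟨hr, hs⟩, dif_pos ⟨by omega, hs⟩]
    exact hp _ _ _ _ (by simp [Fin.le_def]) le_rfl
  an2 := by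
    intro r s hr hs
    unfold extq
    rw [dif_pos ⟨hr, hs⟩, dif_pos ⟨hr, by omega⟩]
    exact hp _ _ _ _ le_rfl (by simp [Fin.le_def])

lemma anti_steps (a b : ℕ) (q : ℕ → ℕ → ℕ)
    (h1 : ∀ r s, r + 1 < a → s < b → q (r + 1) s ≤ q r s)
    (h2 : ∀ r s, r < a → s + 1 < b → q r (s + 1) ≤ q r s)
    (r s d e : ℕ) (hr : r + d < a) (hs : s + e < b) : q (r + d) (s + e) ≤ q r s := by
  have A : ∀ d, r + d < a → q (r + d) (s + e) ≤ q r (s + e) := by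
    intro d
    induction d with
    | zero => intro _; exact le_rfl
    | succ d ih => intro h; exact (h1 (r + d) (s + e) h hs).trans (ih (by omega))
  have B : ∀ e, s + e < b → q r (s + e) ≤ q r s := by
    intro e
    induction e with
    | zero => intro _; exact le_rfl
    | succ e ih => intro h; exact (h2 r (s + e) (by omega) h).trans (ih (by omega))
  exact (A d hr).trans (B e hs)

open Classical in
lemma permU_card (a b c : ℕ) : permU a b c =
    (Fintype.card {σ : Mon (a+b) (a+c) (b+c) (a+b+c-2) ≃ Mon (a+b) (a+c) (b+c) (a+b+c-2+1) //
      ∀ v, Dv v (σ v)} : ℤ) := by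
  unfold permU
  rw [Fintype.card_subtype, Finset.card_eq_sum_ones, Nat.cast_sum, Finset.sum_filter]
  apply Finset.sum_congr rfl
  intro σ _
  by_cases h : ∀ v, Dv v (σ v)
  · rw [if_pos h]
    rw [Finset.prod_eq_one]
    · simp
    · intro v _
      simp only [Umat, Matrix.of_apply]
      exact if_pos (h v)
  · rw [if_neg h]
    push Not at h
    obtain ⟨v, hv⟩ := h
    apply Finset.prod_eq_zero (Finset.mem_univ v)
    simp only [Umat, Matrix.of_apply]
    exact if_neg hv

/-- The permanent of the middle multiplication matrix `U_m` (`m = a+b+c-2`) on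
`ℤ[x,y,z]/(x^{a+b},y^{a+c},z^{b+c})` equals the number of plane partitions in an
`a × b × c` box. -/
theorem stmt9 (a b c : ℕ) (ha : 1 ≤ a) (hb : 1 ≤ b) (hc : 1 ≤ c) :
    permU a b c = (PPcount a b c : ℤ) := by
  classical
  rw [permU_card]
  unfold PPcount
  congr 1
  apply le_antisymm
  · refine Fintype.card_le_of_injective (fun σ => ⟨fun r s =>
      ⟨Tl.pp a b c (sy σ.1) r s, Nat.lt_succ_of_le (Tl.pp_le _ _)⟩, ?_⟩) ?_
    · intro r r' s s' hr hs
      have T := Tl_of ha hb hc σ.1 σ.2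
      have := anti_steps a b (Tl.pp a b c (sy σ.1)) T.pp_anti1 T.pp_anti2 r s (r' - r) (s' - s)
        (by omega) (by omega)
      rw [show (r : ℕ) + (r' - r) = r' by omega, show (s : ℕ) + (s' - s) = s' by omega] at this
      exact this
    · intro σ σ' h
      have T := Tl_of ha hb hc σ.1 σ.2
      have T' := Tl_of ha hb hc σ'.1 σ'.2
      have hpp : ∀ r s, r < a → s < b →
          Tl.pp a b c (sy σ.1) r s = Tl.pp a b c (sy σ'.1) r s := by
        intro r s hr hs
        have h1 := congrFun (congrFun (congrArg Subtype.val h) ⟨r, hr⟩) ⟨s, hs⟩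
        exact congrArg Fin.val h1
      apply Subtype.ext
      apply Equiv.ext
      intro v
      have f1 := v.1.1.2
      have f2 := v.1.2.1.2
      have f3 := v.1.2.2.2
      have e := v.2
      have hxy := T.xy_eq T' hb hpp v.1.1 v.1.2.1 f1 f2 (by omega) (by omega)
      rw [sx_val _ v (σ.2 v), sx_val _ v (σ'.2 v), sy_val _ v (σ.2 v),
        sy_val _ v (σ'.2 v)] at hxy
      obtain ⟨d1, d2, d3⟩ := σ.2 v
      obtain ⟨d1', d2', d3'⟩ := σ'.2 v
      apply Mon.ext2
      · omega
      · omega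
  · choose F hF using fun p : {p : Fin a → Fin b → Fin (c + 1) //
      ∀ i i' j j', i ≤ i' → j ≤ j' → (p i' j' : ℕ) ≤ (p i j : ℕ)} =>
      exists_sigma (extq_isPP p.1 p.2) ha hb hc
    refine Fintype.card_le_of_injective F ?_
    intro p p' h
    have Q := extq_isPP p.1 p.2
    have Q' := extq_isPP p'.1 p'.2
    have h1 := hF p
    have h2 := hF p'
    rw [← h] at h2
    apply Subtype.ext
    funext r s
    apply Fin.ext
    have l1 := q_le Q Q' (F p).1 h1 h2 r s r.2 s.2
    have l2 := q_le Q' Q (F p).1 h2 h1 r s r.2 s.2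
    have e := le_antisymm l2 l1
    simpa [extq] using e
end

section
/- For positive integers a, b, c, with A = a+b, B = a+c, C = b+c, m = a+b+c-2, the absolute value of the determinant of U_m : R_m → R_{m+1} equals ∏_{i=1}^a ∏_{j=1}^b ∏_{k=1}^c (i+j+k-1)/(i+j+k-2), MacMahon's count of plane partitions in an a×b×c box. -/
open Matrix

section aux
open Polynomial

noncomputable def binMat (a b n : ℕ) : Matrix (Fin a) (Fin a) ℤ :=
  Matrix.of fun i l => ((1 + X : ℤ[X]) ^ n * X ^ (l : ℕ)).coeff (b + i)

lemma sum_choose_X (a j : ℕ) (hj : j < a) :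
    ∑ l : Fin a, (X : ℤ[X]) ^ (l : ℕ) * C ((j.choose l : ℕ) : ℤ) = (1 + X) ^ j := by
  rw [Fin.sum_univ_eq_sum_range (fun l => (X : ℤ[X]) ^ l * C ((j.choose l : ℕ) : ℤ)) a,
    add_comm, add_pow]
  symm
  apply Finset.sum_subset_zero_on_sdiff
  · intro x; simp; omega
  · intro x hx
    simp at hx
    rw [Nat.choose_eq_zero_of_lt (by omega)]; simp
  · intro x hx
    simp

lemma det_choose_tri (a : ℕ) :
    (Matrix.of fun (l j : Fin a) => (((j : ℕ).choose l : ℕ) : ℤ)).det = 1 := by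
  rw [Matrix.det_of_isUpperTriangular]
  · simp
  · intro i j hij
    simp only [id] at hij
    simp [Nat.choose_eq_zero_of_lt (show (j : ℕ) < i from hij)]

lemma binMat_mul (a b n : ℕ) :
    binMat a b n * (Matrix.of fun (l j : Fin a) => (((j : ℕ).choose l : ℕ) : ℤ)) =
      Matrix.of fun (i j : Fin a) => (((n + j).choose (b + i) : ℕ) : ℤ) := by
  ext i j
  simp only [Matrix.mul_apply, binMat, Matrix.of_apply]
  have h := sum_choose_X a j j.2
  have : (((n + j).choose (b + i) : ℕ) : ℤ) = ((1 + X : ℤ[X]) ^ (n + (j : ℕ))).coeff (b + i) := by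
    rw [coeff_one_add_X_pow]
  rw [this, pow_add, ← h, Finset.mul_sum, finsetSum_coeff]
  refine Finset.sum_congr rfl fun l _ => ?_
  rw [← mul_assoc, coeff_mul_C]

lemma det_desc (a c : ℕ) :
    (Matrix.of fun (i j : Fin a) => (((c + j).descFactorial i : ℕ) : ℤ)).det
      = ∏ i : Fin a, ((i : ℕ).factorial : ℤ) := by
  have h := det_eval_matrixOfPolynomials_eq_det_vandermonde (fun i : Fin a => (((c + i : ℕ) : ℤ)))
      (fun i => descPochhammer ℤ i)
      (fun i => descPochhammer_natDegree ℤ i)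
      (fun i => monic_descPochhammer ℤ i)
  rw [← Matrix.det_transpose]
  have e : (Matrix.of fun (i j : Fin a) => (((c + j).descFactorial i : ℕ) : ℤ))ᵀ =
    Matrix.of (fun (i j : Fin a) => (descPochhammer ℤ j).eval (((c + i : ℕ) : ℤ))) := by
    ext i j
    simp only [Matrix.transpose_apply, Matrix.of_apply]
    rw [descPochhammer_eval_eq_descFactorial]
  rw [e, ← h]
  have h2 := det_vandermonde_add (fun i : Fin a => ((i : ℕ) : ℤ)) (c : ℤ)
  have h3 : (fun i : Fin a => (((c + i : ℕ) : ℤ))) = fun i : Fin a => ((i : ℕ) : ℤ) + c := by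
    ext i; push_cast; ring
  rw [h3, h2]
  cases a with
  | zero => simp
  | succ k =>
    rw [det_vandermonde_id_eq_superFactorial, ← Nat.prod_range_succ_factorial,
      ← Fin.prod_univ_eq_prod_range]
    push_cast; rfl

lemma choose_fact (b c i j : ℕ) :
    (b + i).factorial * (b + c + j).choose (b + i) * (c + j).factorial =
      (b + c + j).factorial * (c + j).descFactorial i := by
  rcases le_or_gt i (c + j) with h | h
  · have h1 := Nat.choose_mul_factorial_mul_factorial (show b + i ≤ b + c + j by omega)
    have h2 := Nat.factorial_mul_descFactorial h
    rw [show b + c + j - (b + i) = c + j - i by omega] at h1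
    rw [← h1, ← h2]; ring
  · rw [Nat.choose_eq_zero_of_lt (by omega), Nat.descFactorial_eq_zero_iff_lt.2 h]; simp

lemma binMat_det (a b c : ℕ) :
    (binMat a b (b + c)).det * ∏ i : Fin a, (((b + i).factorial * (c + i).factorial : ℕ) : ℤ) =
      ∏ i : Fin a, (((i : ℕ).factorial * (b + c + i).factorial : ℕ) : ℤ) := by
  have h := congrArg Matrix.det (binMat_mul a b (b + c))
  rw [Matrix.det_mul, det_choose_tri, mul_one] at h
  rw [h]
  have h1 : Matrix.of (fun (i j : Fin a) => ((c + j).factorial : ℤ) * (Matrix.of (fun (i j : Fin a) =>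
     ((b + i).factorial : ℤ) * (Matrix.of fun (i j : Fin a) => (((b + c + j).choose (b + i) : ℕ) : ℤ)) i j)) i j) = 
     Matrix.of (fun (i j : Fin a) => ((b + c + j).factorial : ℤ) * (Matrix.of fun (i j : Fin a) => (((c + j).descFactorial i : ℕ) : ℤ)) i j) := by
    ext i j
    simp only [Matrix.of_apply]
    have := choose_fact b c i j
    rw [mul_comm]
    exact_mod_cast this
  have h2 := congrArg Matrix.det h1
  rw [Matrix.det_mul_row, Matrix.det_mul_column, Matrix.det_mul_row, det_desc] at h2
  push_cast
  rw [Finset.prod_mul_distrib, Finset.prod_mul_distrib]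
  linarith
end aux

lemma boxrow (i c j : ℕ) : (∏ k : Fin c, (i + j + k + 2)) * (i + j + 1) =
    (∏ k : Fin c, (i + j + k + 1)) * (i + j + c + 1) := by
  induction c with
  | zero => simp
  | succ c ih =>
    rw [Fin.prod_univ_castSucc, Fin.prod_univ_castSucc]
    simp only [Fin.val_castSucc, Fin.val_last]
    linear_combination (i + j + c + 2) * ih

lemma boxslab (i b c : ℕ) :
    (∏ j : Fin b, ∏ k : Fin c, (i + j + k + 2)) * ((b + i).factorial * (c + i).factorial) =
    (∏ j : Fin b, ∏ k : Fin c, (i + j + k + 1)) * (i.factorial * (b + c + i).factorial) := by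
  induction b with
  | zero => simp
  | succ b ih =>
    rw [Fin.prod_univ_castSucc, Fin.prod_univ_castSucc]
    simp only [Fin.val_castSucc, Fin.val_last]
    have h := boxrow i c b
    rw [show b + 1 + i = (b + i) + 1 by ring, show b + 1 + c + i = (b + c + i) + 1 by ring,
      Nat.factorial_succ, Nat.factorial_succ]
    calc _ = ((∏ j : Fin b, ∏ k : Fin c, (i + j + k + 2)) * ((b + i).factorial * (c + i).factorial)) *
        ((∏ k : Fin c, (i + b + k + 2)) * (i + b + 1)) := by ring
      _ = _ := by rw [ih, h]; ring

lemma binMat_box (a b c : ℕ) :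
    (binMat a b (b + c)).det.natAbs * ∏ i : Fin a, ∏ j : Fin b, ∏ k : Fin c, ((i : ℕ) + j + k + 1)
      = ∏ i : Fin a, ∏ j : Fin b, ∏ k : Fin c, ((i : ℕ) + j + k + 2) := by
  have h := congrArg Int.natAbs (binMat_det a b c)
  rw [Int.natAbs_mul, ← Nat.cast_prod, ← Nat.cast_prod, Int.natAbs_natCast, Int.natAbs_natCast] at h
  have hs : (∏ i : Fin a, ∏ j : Fin b, ∏ k : Fin c, ((i : ℕ) + j + k + 2)) *
     (∏ i : Fin a, ((b + i).factorial * (c + i).factorial)) = 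
     (∏ i : Fin a, ∏ j : Fin b, ∏ k : Fin c, ((i : ℕ) + j + k + 1)) *
     (∏ i : Fin a, ((i : ℕ).factorial * (b + c + i).factorial)) := by
    rw [← Finset.prod_mul_distrib, ← Finset.prod_mul_distrib]
    exact Finset.prod_congr rfl fun i _ => boxslab i b c
  have hpos : 0 < ∏ i : Fin a, ((b + i).factorial * (c + i).factorial) :=
    Finset.prod_pos fun i _ => by positivity
  apply Nat.eq_of_mul_eq_mul_right hpos
  rw [hs, ← h]; ring

section elimination
open Polynomial

/-- The functional `coefficient of x^t` after substituting `z = -(x+y)` (with `y = 1`). -/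
noncomputable def phi (t p k : ℕ) : ℤ := ((-(1 + X : ℤ[X])) ^ k * X ^ p).coeff t

lemma phi_rec (t p k : ℕ) : phi t (p + 1) k + phi t p k + phi t p (k + 1) = 0 := by
  unfold phi
  rw [← coeff_add, ← coeff_add]
  convert coeff_zero t using 2
  ring

lemma phi_big (t p k : ℕ) (h : t < p) : phi t p k = 0 := by
  unfold phi
  rw [coeff_mul_X_pow', if_neg (by omega)]

lemma phi_small (t p k : ℕ) (h : p + k < t) : phi t p k = 0 := by
  unfold phi
  apply coeff_eq_zero_of_natDegree_lt
  refine lt_of_le_of_lt ?_ h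
  rw [add_comm (1 : ℤ[X]) X, ← C_1]
  compute_degree
  omega

lemma sum_point (A B C s p q r : ℕ) (h : p + q + r = s) (F : ℕ → ℕ → ℤ) :
    ∑ w : Mon A B C s, F w.1.1 w.1.2.2 *
      (if (w.1.1 : ℕ) = p ∧ (w.1.2.1 : ℕ) = q ∧ (w.1.2.2 : ℕ) = r then (1 : ℤ) else 0) =
      if p < A ∧ q < B ∧ r < C then F p r else 0 := by
  split_ifs with hh
  · obtain ⟨h1, h2, h3⟩ := hh
    refine (Finset.sum_eq_single (⟨(⟨p, h1⟩, ⟨q, h2⟩, ⟨r, h3⟩), h⟩ : Mon A B C s) ?_ ?_).trans ?_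
    · rintro ⟨⟨x, y, z⟩, hw⟩ _ hne
      rw [if_neg, mul_zero]
      rintro ⟨e1, e2, e3⟩
      apply hne
      apply Subtype.ext
      simp only at e1 e2 e3
      simp only [Prod.mk.injEq, Fin.ext_iff]
      exact ⟨e1, e2, e3⟩
    · intro h; exact absurd (Finset.mem_univ _) h
    · exact (congrArg _ (if_pos ⟨rfl, rfl, rfl⟩)).trans (mul_one _)
  · apply Finset.sum_eq_zero
    rintro ⟨⟨x, y, z⟩, hw⟩ _
    rw [if_neg, mul_zero]
    rintro ⟨e1, e2, e3⟩
    simp only at e1 e2 e3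
    exact hh ⟨e1 ▸ x.2, e2 ▸ y.2, e3 ▸ z.2⟩

lemma Umat_split (A B C s : ℕ) (w : Mon A B C (s + 1)) (v : Mon A B C s) :
    Umat A B C s w v =
      (if (w.1.1 : ℕ) = v.1.1 + 1 ∧ (w.1.2.1 : ℕ) = v.1.2.1 ∧ (w.1.2.2 : ℕ) = v.1.2.2
        then (1 : ℤ) else 0) +
      (if (w.1.1 : ℕ) = v.1.1 ∧ (w.1.2.1 : ℕ) = v.1.2.1 + 1 ∧ (w.1.2.2 : ℕ) = v.1.2.2
        then (1 : ℤ) else 0) +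
      (if (w.1.1 : ℕ) = v.1.1 ∧ (w.1.2.1 : ℕ) = v.1.2.1 ∧ (w.1.2.2 : ℕ) = v.1.2.2 + 1
        then (1 : ℤ) else 0) := by
  have h1 := w.2
  have h2 := v.2
  simp only [Umat, Matrix.of_apply]
  split_ifs <;> first | rfl | omega

lemma sum_U (A B C s : ℕ) (F : ℕ → ℕ → ℤ) (v : Mon A B C s) :
    ∑ w : Mon A B C (s + 1), F w.1.1 w.1.2.2 * Umat A B C s w v =
      (if (v.1.1 : ℕ) + 1 < A then F (v.1.1 + 1) v.1.2.2 else 0) +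
      (if (v.1.2.1 : ℕ) + 1 < B then F v.1.1 v.1.2.2 else 0) +
      (if (v.1.2.2 : ℕ) + 1 < C then F v.1.1 (v.1.2.2 + 1) else 0) := by
  have h2 := v.2
  simp only [Umat_split, mul_add, Finset.sum_add_distrib]
  rw [sum_point _ _ _ _ _ _ _ (by omega), sum_point _ _ _ _ _ _ _ (by omega),
    sum_point _ _ _ _ _ _ _ (by omega)]
  have a1 := v.1.1.2
  have a2 := v.1.2.1.2
  have a3 := v.1.2.2.2
  simp [a1, a2, a3]

def fFun (a b c n m : ℕ) (hn : b + c = n + 1) (hm : m + 1 = a + n) (hb : 1 ≤ b) (hc : 1 ≤ c) :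
    Fin a ⊕ Mon (a + b) (a + c) n m → Mon (a + b) (a + c) (n + 1) m
  | .inl i => ⟨(⟨i, by omega⟩, ⟨a - 1 - i, by omega⟩, ⟨n, by omega⟩), by
      have := i.2; simp only; omega⟩
  | .inr v => ⟨(v.1.1, v.1.2.1, ⟨v.1.2.2, by omega⟩), v.2⟩

def gFun (a b c n m : ℕ) (hn : b + c = n + 1) (hm : m + 1 = a + n) :
    Fin a ⊕ Mon (a + b) (a + c) n m → Mon (a + b) (a + c) (n + 1) (m + 1)
  | .inl i => ⟨(⟨b + i, by omega⟩, ⟨a + c - 1 - i, by omega⟩, ⟨0, by omega⟩), by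
      have := i.2; simp only; omega⟩
  | .inr v => ⟨(v.1.1, v.1.2.1, ⟨v.1.2.2 + 1, by omega⟩), by have := v.2; simp only; omega⟩

lemma Mon_ext {A B C s : ℕ} {v w : Mon A B C s} (h1 : (v.1.1 : ℕ) = w.1.1)
    (h2 : (v.1.2.1 : ℕ) = w.1.2.1) (h3 : (v.1.2.2 : ℕ) = w.1.2.2) : v = w :=
  Subtype.ext (Prod.ext (Fin.ext h1) (Prod.ext (Fin.ext h2) (Fin.ext h3)))

lemma Mon_vals {A B C s : ℕ} {v w : Mon A B C s} (h : v = w) : (v.1.1 : ℕ) = w.1.1 ∧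
    (v.1.2.1 : ℕ) = w.1.2.1 ∧ (v.1.2.2 : ℕ) = w.1.2.2 := by subst h; simp

lemma fFun_bij (a b c n m : ℕ) (hn : b + c = n + 1) (hm : m + 1 = a + n) (hb : 1 ≤ b)
    (hc : 1 ≤ c) : Function.Bijective (fFun a b c n m hn hm hb hc) := by
  constructor
  · rintro (i | v) (j | w) h <;> obtain ⟨h1, h2, h3⟩ := Mon_vals h <;>
      simp only [fFun] at h1 h2 h3
    · exact congrArg _ (Fin.ext h1)
    · have := w.1.2.2.2; omega
    · have := v.1.2.2.2; omega
    · exact congrArg _ (Mon_ext h1 h2 h3)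
  · intro v
    have hs := v.2
    have := v.1.2.2.2
    by_cases h : (v.1.2.2 : ℕ) < n
    · exact ⟨.inr ⟨(v.1.1, v.1.2.1, ⟨v.1.2.2, h⟩), hs⟩, Mon_ext rfl rfl rfl⟩
    · refine ⟨.inl ⟨v.1.1, by omega⟩, Mon_ext rfl ?_ ?_⟩ <;> simp only [fFun] <;> omega

lemma gFun_bij (a b c n m : ℕ) (hn : b + c = n + 1) (hm : m + 1 = a + n) :
    Function.Bijective (gFun a b c n m hn hm) := by
  constructor
  · rintro (i | v) (j | w) h <;> obtain ⟨h1, h2, h3⟩ := Mon_vals h <;>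
      simp only [gFun] at h1 h2 h3
    · exact congrArg _ (Fin.ext (by omega))
    · omega
    · omega
    · exact congrArg _ (Mon_ext h1 h2 (by omega))
  · intro v
    have hs := v.2
    have := v.1.2.2.2
    have h1 := v.1.1.2
    have h2 := v.1.2.1.2
    by_cases h : 1 ≤ (v.1.2.2 : ℕ)
    · refine ⟨.inr ⟨(v.1.1, v.1.2.1, ⟨v.1.2.2 - 1, by omega⟩), by simp only; omega⟩,
        Mon_ext rfl rfl ?_⟩
      simp only [gFun]; omega
    · refine ⟨.inl ⟨v.1.1 - b, by omega⟩, Mon_ext ?_ ?_ ?_⟩ <;> simp only [gFun] <;> omega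

lemma detD (a b c n m : ℕ) (hn : b + c = n + 1) (hm : m + 1 = a + n) (hb : 1 ≤ b)
    (hc : 1 ≤ c) :
    (Matrix.of fun (w v : Mon (a + b) (a + c) n m) => Umat (a + b) (a + c) (n + 1) m
      (gFun a b c n m hn hm (.inr w)) (fFun a b c n m hn hm hb hc (.inr v))).det = 1 := by
  have hT : Matrix.BlockTriangular
      (Matrix.of fun (w v : Mon (a + b) (a + c) n m) => Umat (a + b) (a + c) (n + 1) m
      (gFun a b c n m hn hm (.inr w)) (fFun a b c n m hn hm hb hc (.inr v)))
      (fun v => (v.1.2.2 : ℕ)) := by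
    intro w v h
    have h1 := w.2
    have h2 := v.2
    simp only at h
    refine if_neg ?_
    simp only [gFun, fFun]
    omega
  rw [hT.det]
  apply Finset.prod_eq_one
  intro k _
  refine (congrArg Matrix.det ?_).trans Matrix.det_one
  ext ⟨w, hw⟩ ⟨v, hv⟩
  have h1 := w.2
  have h2 := v.2
  replace hw : (w.1.2.2 : ℕ) = k := hw
  replace hv : (v.1.2.2 : ℕ) = k := hv
  rw [Matrix.one_apply]
  refine if_congr ?_ rfl rfl
  rw [Subtype.mk.injEq]
  simp only [gFun, fFun]
  constructor
  · rintro ⟨e1, e2, e3⟩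
    apply Mon_ext <;> omega
  · rintro rfl
    omega

lemma phi_row (a b c n m : ℕ) (hn : b + c = n + 1) (hm : m + 1 = a + n) (i : ℕ) (hi : i < a)
    (v : Mon (a + b) (a + c) (n + 1) m) :
    ∑ w : Mon (a + b) (a + c) (n + 1) (m + 1),
      phi (b + i) w.1.1 w.1.2.2 * Umat (a + b) (a + c) (n + 1) m w v =
      if (v.1.2.2 : ℕ) < n then 0 else - phi (b + i) v.1.1 (n + 1) := by
  rw [sum_U]
  have hs := v.2
  have h1 := v.1.1.2
  have h2 := v.1.2.1.2
  have h3 := v.1.2.2.2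
  have e1 : (if (v.1.1 : ℕ) + 1 < a + b then phi (b + i) (v.1.1 + 1) v.1.2.2 else 0) =
      phi (b + i) (v.1.1 + 1) v.1.2.2 := by
    split_ifs with h
    · rfl
    · exact (phi_big _ _ _ (by omega)).symm
  have e2 : (if (v.1.2.1 : ℕ) + 1 < a + c then phi (b + i) v.1.1 v.1.2.2 else 0) =
      phi (b + i) v.1.1 v.1.2.2 := by
    split_ifs with h
    · rfl
    · exact (phi_small _ _ _ (by omega)).symm
  rw [e1, e2]
  have hr := phi_rec (b + i) v.1.1 v.1.2.2
  split_ifs with h h' h'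
  · exact hr
  · omega
  · omega
  · have : (v.1.2.2 : ℕ) = n := by omega
    rw [this] at hr ⊢
    linarith

lemma det_reduce (a b c n m : ℕ) (hn : b + c = n + 1) (hm : m + 1 = a + n) (hb : 1 ≤ b)
    (hc : 1 ≤ c) :
    ((Umat (a + b) (a + c) (n + 1) m).submatrix (gFun a b c n m hn hm)
      (fFun a b c n m hn hm hb hc)).det.natAbs = (binMat a b (b + c)).det.natAbs := by
  set f := fFun a b c n m hn hm hb hc with hf
  set g := gFun a b c n m hn hm with hg
  set U := Umat (a + b) (a + c) (n + 1) m with hU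
  let T : Matrix (Fin a ⊕ Mon (a + b) (a + c) n m) (Fin a ⊕ Mon (a + b) (a + c) n m) ℤ :=
    Matrix.fromBlocks 1 (Matrix.of fun i w => phi (b + i) (g (.inr w)).1.1 (g (.inr w)).1.2.2) 0 1
  have hT : T.det = 1 := by simp [T]
  have hTl : ∀ (i : Fin a) s, T (.inl i) s = phi (b + i) (g s).1.1 (g s).1.2.2 := by
    rintro i (l | w)
    · simp only [T, Matrix.fromBlocks_apply₁₁, Matrix.one_apply, hg, gFun, phi, pow_zero, one_mul,
        coeff_X_pow]
      refine if_congr ?_ rfl rfl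
      rw [Fin.ext_iff]; omega
    · rfl
  have hprod : T * U.submatrix g f = Matrix.fromBlocks
      ((-(-1) ^ (n + 1) : ℤ) • binMat a b (b + c)) 0
      (Matrix.of fun w l => U (g (.inr w)) (f (.inl l)))
      (Matrix.of fun w v => U (g (.inr w)) (f (.inr v))) := by
    have hrow : ∀ (i : Fin a) t, (T * U.submatrix g f) (.inl i) t =
        if ((f t).1.2.2 : ℕ) < n then 0 else - phi (b + i) (f t).1.1 (n + 1) := by
      intro i t
      rw [← phi_row a b c n m hn hm i i.2 (f t), Matrix.mul_apply]
      simp only [hTl, Matrix.submatrix_apply]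
      exact (gFun_bij a b c n m hn hm).sum_comp
        (fun w => phi (b + i) w.1.1 w.1.2.2 * U w (f t))
    ext (i | w) (l | v)
    · rw [hrow, if_neg (by simp [hf, fFun])]
      simp only [Matrix.fromBlocks_apply₁₁, Matrix.smul_apply, binMat, Matrix.of_apply, smul_eq_mul,
        phi, hf, fFun, hn]
      rw [neg_pow, neg_mul, ← coeff_C_mul]
      simp [mul_assoc]
    · rw [hrow, if_pos (by simp [hf, fFun])]
      rfl
    · rw [Matrix.mul_apply, Fintype.sum_sum_type]
      simp [T, Matrix.one_apply]
    · rw [Matrix.mul_apply, Fintype.sum_sum_type]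
      simp [T, Matrix.one_apply]
  have h := congrArg Matrix.det hprod
  rw [Matrix.det_mul, hT, one_mul, Matrix.det_fromBlocks_zero₁₂, Matrix.det_smul,
    detD a b c n m hn hm hb hc, mul_one] at h
  rw [h, Int.natAbs_mul, Int.natAbs_pow, Int.natAbs_neg, Int.natAbs_pow]
  simp

end elimination

/-- MacMahon's formula: the absolute value of `det U_m` equals
`∏_{i=1}^a ∏_{j=1}^b ∏_{k=1}^c (i+j+k-1)/(i+j+k-2)` (stated multiplied out). -/
theorem stmt11 (a b c : ℕ) (ha : 1 ≤ a) (hb : 1 ≤ b) (hc : 1 ≤ c)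
    (e : Mon (a+b) (a+c) (b+c) (a+b+c-2) ≃ Mon (a+b) (a+c) (b+c) (a+b+c-2+1)) :
    (((Umat (a+b) (a+c) (b+c) (a+b+c-2)).submatrix e id).det).natAbs *
        ∏ i : Fin a, ∏ j : Fin b, ∏ k : Fin c, ((i : ℕ) + j + k + 1)
      = ∏ i : Fin a, ∏ j : Fin b, ∏ k : Fin c, ((i : ℕ) + j + k + 2) := by
  have key : ∀ (n m C : ℕ) (hn : b + c = n + 1) (hm : m + 1 = a + n) (hC : C = n + 1)
      (e : Mon (a+b) (a+c) C m ≃ Mon (a+b) (a+c) C (m+1)),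
      (((Umat (a+b) (a+c) C m).submatrix e id).det).natAbs =
        (binMat a b (b + c)).det.natAbs := by
    intro n m C hn hm hC e
    subst hC
    rw [← det_reduce a b c n m hn hm hb hc]
    let f := Equiv.ofBijective _ (fFun_bij a b c n m hn hm hb hc)
    let g := Equiv.ofBijective _ (gFun_bij a b c n m hn hm)
    have h := Matrix.abs_det_submatrix_equiv_equiv (e.trans g.symm) f.symm
      ((Umat (a + b) (a + c) (n + 1) m).submatrix g f)
    rw [Matrix.submatrix_submatrix] at h
    have h1 : (g : _ → _) ∘ (e.trans g.symm) = e := by ext x; simp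
    have h2 : (f : _ → _) ∘ f.symm = id := by ext x; simp
    rw [h1, h2] at h
    exact Int.natAbs_eq_natAbs_iff.2 (abs_eq_abs.1 h)
  rw [key (b + c - 1) (a + b + c - 2) (b + c) (by omega) (by omega) (by omega) e]
  exact binMat_box a b c
end

section
/- For positive integers a, b, c, the number of plane partitions fitting in an a×b×c box equals the number of rhombus tilings of the hexagon with side lengths a, b, c, a, b, c, equivalently the number of perfect matchings of the associated bipartite honeycomb graph whose vertices are the monomials x^i y^j z^k of degrees a+b+c-2 and a+b+c-1 nonzero in ℤ[x,y,z]/(x^{a+b},y^{a+c},z^{b+c}), with an edge whenever one monomial divides the other. -/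
open Matrix

namespace HexPP

def Wt (a b c : ℕ) (i j : ℤ) : ℤ :=
  if 0 ≤ i ∧ i < a + b ∧ 0 ≤ j ∧ j < a + c ∧ (a : ℤ) - 1 ≤ i + j ∧ i + j ≤ a + b + c - 2
  then 1 else 0

def Bt (a b c : ℕ) (i j : ℤ) : ℤ :=
  if 0 ≤ i ∧ i < a + b ∧ 0 ≤ j ∧ j < a + c ∧ (a : ℤ) ≤ i + j ∧ i + j ≤ a + b + c - 1
  then 1 else 0

/-- The tiling of the empty plane partition. -/
def Xr (a b : ℕ) (i j : ℤ) : ℤ :=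
  if 0 ≤ j ∧ j < a ∧ (a : ℤ) - 1 ≤ i + j ∧ i + j ≤ a + b - 2 then 1 else 0

def Yr (a b c : ℕ) (i j : ℤ) : ℤ :=
  if (b : ℤ) ≤ i ∧ i < a + b ∧ (a : ℤ) + b - 1 ≤ i + j ∧ i + j ≤ a + b + c - 2 then 1 else 0

def Zr (a b c : ℕ) (i j : ℤ) : ℤ :=
  if 0 ≤ i ∧ i < b ∧ (a : ℤ) ≤ j ∧ j < a + c then 1 else 0

structure IsT (a b c : ℕ) (X Y Z : ℤ → ℤ → ℤ) : Prop where
  hX : ∀ i j, 0 ≤ X i j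
  hY : ∀ i j, 0 ≤ Y i j
  hZ : ∀ i j, 0 ≤ Z i j
  hW : ∀ i j, X i j + Y i j + Z i j = Wt a b c i j
  hB : ∀ i j, X (i-1) j + Y i (j-1) + Z i j = Bt a b c i j

structure IsN (a b c : ℕ) (N : ℤ → ℤ → ℤ) : Prop where
  hX : ∀ i j, N i j ≤ N i (j-1) + Xr a b i j
  hY : ∀ i j, N (i-1) j ≤ N i j + Yr a b c i j
  hZ : ∀ i j, N i (j-1) ≤ N (i-1) j + Zr a b c i j
  v1 : ∀ i j, i < 0 → N i j = 0
  v2 : ∀ i j, (a:ℤ) + b - 1 ≤ i → N i j = 0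
  v3 : ∀ i j, j < 0 → N i j = 0
  v4 : ∀ i j, (a:ℤ) + c - 1 ≤ j → N i j = 0

lemma ref_isT (a b c : ℕ) : IsT a b c (Xr a b) (Yr a b c) (Zr a b c) := by
  constructor
  · intro i j; unfold Xr; split_ifs <;> omega
  · intro i j; unfold Yr; split_ifs <;> omega
  · intro i j; unfold Zr; split_ifs <;> omega
  · intro i j; unfold Xr Yr Zr Wt; split_ifs <;> omega
  · intro i j; unfold Xr Yr Zr Bt; split_ifs <;> omega

lemma IsN.toT {a b c : ℕ} {N : ℤ → ℤ → ℤ} (h : IsN a b c N) :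
    IsT a b c (fun i j => Xr a b i j + N i (j-1) - N i j)
      (fun i j => Yr a b c i j + N i j - N (i-1) j)
      (fun i j => Zr a b c i j + N (i-1) j - N i (j-1)) := by
  have R := ref_isT a b c
  constructor
  · intro i j; have := h.hX i j; omega
  · intro i j; have := h.hY i j; omega
  · intro i j; have := h.hZ i j; omega
  · intro i j; have := R.hW i j; omega
  · intro i j; have := R.hB i j; omega

lemma IsN.toT_inj {a b c : ℕ} {N N' : ℤ → ℤ → ℤ} (h : IsN a b c N) (h' : IsN a b c N')
    (e : ∀ i j, Xr a b i j + N i (j-1) - N i j = Xr a b i j + N' i (j-1) - N' i j) :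
    N = N' := by
  have key : ∀ (n : ℕ) (i : ℤ), N i ((n:ℤ) - 1) = N' i ((n:ℤ) - 1) := by
    intro n i
    induction n with
    | zero => rw [h.v3 _ _ (by simp), h'.v3 _ _ (by simp)]
    | succ n ih =>
      have := e i n
      have e1 : ((n+1 : ℕ) : ℤ) - 1 = n := by push_cast; ring
      rw [e1]; omega
  funext i j
  by_cases hj : j < 0
  · rw [h.v3 _ _ hj, h'.v3 _ _ hj]
  · have := key (j+1).toNat i
    have e1 : (((j+1).toNat : ℕ) : ℤ) - 1 = j := by omega
    rwa [e1] at this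

/-- Height function of a tiling. -/
noncomputable def Nof (a b c : ℕ) (X : ℤ → ℤ → ℤ) (i j : ℤ) : ℤ :=
  ∑ j' ∈ Finset.Ioc j ((a:ℤ) + c), (X i j' - Xr a b i j')

lemma IsT.supp {a b c : ℕ} {X Y Z : ℤ → ℤ → ℤ} (h : IsT a b c X Y Z) (i j : ℤ)
    (hw : Wt a b c i j = 0) : X i j = 0 ∧ Y i j = 0 ∧ Z i j = 0 := by
  have := h.hX i j; have := h.hY i j; have := h.hZ i j; have := h.hW i j
  omega

lemma Nof_X {a b c : ℕ} {X Y Z : ℤ → ℤ → ℤ} (h : IsT a b c X Y Z) (i j : ℤ) :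
    Nof a b c X i (j-1) = Nof a b c X i j + X i j - Xr a b i j := by
  unfold Nof
  by_cases hj : j ≤ (a:ℤ) + c
  · have : Finset.Ioc (j-1) ((a:ℤ)+c) = insert j (Finset.Ioc j ((a:ℤ)+c)) := by
      ext x; simp only [Finset.mem_Ioc, Finset.mem_insert]; omega
    rw [this, Finset.sum_insert (by simp)]; ring
  · have hw : Wt a b c i j = 0 := by unfold Wt; split_ifs <;> omega
    rw [(h.supp i j hw).1, ((ref_isT a b c).supp i j hw).1,
      Finset.Ioc_eq_empty (by omega), Finset.Ioc_eq_empty (by omega)]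
    simp

lemma Nof_v4 {a b c : ℕ} {X Y Z : ℤ → ℤ → ℤ} (h : IsT a b c X Y Z) (i j : ℤ)
    (hj : (a:ℤ) + c - 1 ≤ j) : Nof a b c X i j = 0 := by
  unfold Nof
  apply Finset.sum_eq_zero
  intro x hx
  rw [Finset.mem_Ioc] at hx
  have hw : Wt a b c i x = 0 := by unfold Wt; split_ifs <;> omega
  rw [(h.supp i x hw).1, ((ref_isT a b c).supp i x hw).1]; simp

lemma Nof_Y {a b c : ℕ} {X Y Z : ℤ → ℤ → ℤ} (h : IsT a b c X Y Z) (i j : ℤ) :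
    Nof a b c X i j = Nof a b c X (i-1) j + Y i j - Yr a b c i j := by
  have R := ref_isT a b c
  have big : ∀ j, (a:ℤ) + c ≤ j →
      Nof a b c X i j = Nof a b c X (i-1) j + Y i j - Yr a b c i j := by
    intro j hj
    have hw : Wt a b c i j = 0 := by unfold Wt; split_ifs <;> omega
    rw [Nof_v4 h _ _ (by omega), Nof_v4 h _ _ (by omega), (h.supp i j hw).2.1,
      (R.supp i j hw).2.1]; simp
  have key : ∀ (n : ℕ), Nof a b c X i ((a:ℤ)+c-n) =
      Nof a b c X (i-1) ((a:ℤ)+c-n) + Y i ((a:ℤ)+c-n) - Yr a b c i ((a:ℤ)+c-n) := by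
    intro n
    induction n with
    | zero => exact big _ (by simp)
    | succ n ih =>
      have e1 : (a:ℤ)+c-((n+1:ℕ):ℤ) = (a:ℤ)+c-n - 1 := by push_cast; ring
      rw [e1]
      generalize (a:ℤ)+c-n = j at *
      have := Nof_X h i j
      have := Nof_X h (i-1) j
      have := h.hW i j
      have := h.hB i j
      have := R.hW i j
      have := R.hB i j
      omega
  by_cases hj : (a:ℤ)+c ≤ j
  · exact big j hj
  · have := key ((a:ℤ)+c-j).toNat
    have e1 : (a:ℤ)+c-(((a:ℤ)+c-j).toNat : ℤ) = j := by omega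
    rwa [e1] at this

lemma Nof_v1 {a b c : ℕ} {X Y Z : ℤ → ℤ → ℤ} (h : IsT a b c X Y Z) (i j : ℤ)
    (hi : i < 0) : Nof a b c X i j = 0 := by
  unfold Nof
  apply Finset.sum_eq_zero
  intro x hx
  have hw : Wt a b c i x = 0 := by unfold Wt; split_ifs <;> omega
  rw [(h.supp i x hw).1, ((ref_isT a b c).supp i x hw).1]; simp

lemma IsT.toN {a b c : ℕ} {X Y Z : ℤ → ℤ → ℤ} (h : IsT a b c X Y Z) :
    IsN a b c (Nof a b c X) := by
  have R := ref_isT a b c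
  constructor
  · intro i j; have := Nof_X h i j; have := h.hX i j; omega
  · intro i j; have := Nof_Y h i j; have := h.hY i j; omega
  · intro i j
    have := Nof_X h i j; have := Nof_Y h i j; have := h.hZ i j
    have := h.hW i j; have := R.hW i j; omega
  · exact Nof_v1 h
  · intro i j hi
    unfold Nof
    apply Finset.sum_eq_zero
    intro x hx
    have hw : Bt a b c (i+1) x = 0 := by unfold Bt; split_ifs <;> omega
    have h1 := h.hB (i+1) x
    have h2 := R.hB (i+1) x
    simp only [add_sub_cancel_right] at h1 h2
    have := h.hX i x; have := h.hY (i+1) (x-1); have := h.hZ (i+1) x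
    have := R.hX i x; have := R.hY (i+1) (x-1); have := R.hZ (i+1) x
    omega
  · intro i j hj
    by_cases hi : i < 0
    · exact Nof_v1 h i j hi
    · have key : ∀ n : ℕ, Nof a b c X ((n:ℤ)-1) j = 0 := by
        intro n
        induction n with
        | zero => exact Nof_v1 h _ _ (by simp)
        | succ n ih =>
          have e1 : ((n+1 : ℕ) : ℤ) - 1 = n := by push_cast; ring
          have hw : Wt a b c n j = 0 := by unfold Wt; split_ifs <;> omega
          rw [e1, Nof_Y h, ih, (h.supp _ j hw).2.1, (R.supp _ j hw).2.1]; simp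
      have := key (i+1).toNat
      have e1 : (((i+1).toNat : ℕ) : ℤ) - 1 = i := by omega
      rwa [e1] at this
  · exact Nof_v4 h

/-! ### height functions to plane partitions -/

/-- Normalised height along the line through the cube `(s,t,r)`. -/
def Nt (a b : ℕ) (N : ℤ → ℤ → ℤ) (s t r : ℤ) : ℤ :=
  N (s - t + b - 1) (r - s + a - 1) - min s (min t r)

section
variable {a b c : ℕ} {N : ℤ → ℤ → ℤ}

lemma Nt_s1 (h : IsN a b c N) (s t r : ℤ) : Nt a b N (s+1) t r ≤ Nt a b N s t r := by
  unfold Nt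
  have := h.hZ (s + 1 - t + b - 1) (r - s + a - 1)
  have e1 : s + 1 - t + b - 1 - 1 = s - t + b - 1 := by ring
  have e2 : r - (s+1) + a - 1 = r - s + a - 1 - 1 := by ring
  rw [e1] at this; rw [e2]
  unfold Zr at this
  split_ifs at this <;> omega

lemma Nt_t1 (h : IsN a b c N) (s t r : ℤ) : Nt a b N s (t+1) r ≤ Nt a b N s t r := by
  unfold Nt
  have := h.hY (s - t + b - 1) (r - s + a - 1)
  have e1 : s - (t+1) + b - 1 = s - t + b - 1 - 1 := by ring
  rw [e1]
  unfold Yr at this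
  split_ifs at this <;> omega

lemma Nt_r1 (h : IsN a b c N) (s t r : ℤ) : Nt a b N s t (r+1) ≤ Nt a b N s t r := by
  unfold Nt
  have := h.hX (s - t + b - 1) (r + 1 - s + a - 1)
  have e1 : r + 1 - s + a - 1 - 1 = r - s + a - 1 := by ring
  rw [e1] at this
  unfold Xr at this
  split_ifs at this <;> omega

lemma anti_of_step (f : ℤ → ℤ) (hf : ∀ x, f (x+1) ≤ f x) {x y : ℤ} (hxy : x ≤ y) : f y ≤ f x :=
  antitone_int_of_succ_le hf hxy

lemma Nt_mono (h : IsN a b c N) {s t r s' t' r' : ℤ} (hs : s ≤ s') (ht : t ≤ t') (hr : r ≤ r') :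
    Nt a b N s' t' r' ≤ Nt a b N s t r :=
  calc Nt a b N s' t' r' ≤ Nt a b N s t' r' :=
        anti_of_step (fun x => Nt a b N x t' r') (fun x => Nt_s1 h x _ _) hs
    _ ≤ Nt a b N s t r' := anti_of_step (fun x => Nt a b N s x r') (fun x => Nt_t1 h _ x _) ht
    _ ≤ Nt a b N s t r := anti_of_step (fun x => Nt a b N s t x) (fun x => Nt_r1 h _ _ x) hr

lemma Nt_box (h : IsN a b c N) {s t r : ℤ} (hs : 0 ≤ s) (ht : 0 ≤ t) (hr : 0 ≤ r)
    (hp : 0 < Nt a b N s t r) : s < a ∧ t < b ∧ r < c := by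
  refine ⟨?_, ?_, ?_⟩ <;> by_contra hc
  · have := Nt_mono h (s := a) (by omega : (a:ℤ) ≤ s) ht hr
    have e : Nt a b N a 0 0 = 0 := by
      unfold Nt; rw [h.v2 _ _ (by omega)]; simp
    omega
  · have := Nt_mono h hs (by omega : (b:ℤ) ≤ t) hr
    have e : Nt a b N 0 b 0 = 0 := by
      unfold Nt; rw [h.v1 _ _ (by omega)]; simp
    omega
  · have := Nt_mono h hs ht (by omega : (c:ℤ) ≤ r)
    have e : Nt a b N 0 0 c = 0 := by
      unfold Nt; rw [h.v4 _ _ (by omega)]; simp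
    omega

lemma Nt_nonneg (h : IsN a b c N) {s t r : ℤ} (hm : min s (min t r) = 0) :
    0 ≤ Nt a b N s t r := by
  have h1 : 0 ≤ s := by omega
  have h2 : 0 ≤ t := by omega
  have h3 : 0 ≤ r := by omega
  rcases (by omega : s = 0 ∨ t = 0 ∨ r = 0) with h0 | h0 | h0
  · have := Nt_mono h (le_refl s) (by omega : t ≤ t + b) (le_refl r)
    refine le_trans ?_ this
    unfold Nt; rw [h.v1 _ _ (by omega)]; omega
  · have := Nt_mono h (by omega : s ≤ s + a) (le_refl t) (le_refl r)
    refine le_trans ?_ this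
    unfold Nt; rw [h.v2 _ _ (by omega)]; omega
  · have := Nt_mono h (by omega : s ≤ s + a) (le_refl t) (le_refl r)
    refine le_trans ?_ this
    unfold Nt; rw [h.v3 _ _ (by omega)]; omega

lemma exists_base (a b : ℕ) (i j : ℤ) : ∃ s t r : ℤ, min s (min t r) = 0 ∧
    i = s - t + b - 1 ∧ j = r - s + a - 1 := by
  refine ⟨-(min 0 (min (b-1-i) (j-a+1))), -(min 0 (min (b-1-i) (j-a+1))) + (b-1-i),
    -(min 0 (min (b-1-i) (j-a+1))) + (j-a+1), ?_, ?_, ?_⟩ <;> omega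

lemma N_le_of {N' : ℤ → ℤ → ℤ} (h : IsN a b c N) (h' : IsN a b c N')
    (e : ∀ s t r : ℕ, s < a → t < b → r < c → 0 < Nt a b N' s t r → 0 < Nt a b N s t r)
    (i j : ℤ) : N' i j ≤ N i j := by
  obtain ⟨s, t, r, hm, hi, hj⟩ := exists_base a b i j
  by_contra hlt
  have h0 : 0 ≤ N i j := by
    have := Nt_nonneg h hm
    unfold Nt at this; rw [← hi, ← hj] at this; omega
  set d := N i j with hd
  have hi' : s + d - (t + d) + b - 1 = i := by omega
  have hj' : r + d - (s + d) + a - 1 = j := by omega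
  have p' : 0 < Nt a b N' (s+d) (t+d) (r+d) := by
    unfold Nt; rw [hi', hj']; omega
  have p : ¬ 0 < Nt a b N (s+d) (t+d) (r+d) := by
    unfold Nt; rw [hi', hj']; omega
  obtain ⟨b1, b2, b3⟩ := Nt_box h' (by omega) (by omega) (by omega) p'
  have := e (s+d).toNat (t+d).toNat (r+d).toNat (by omega) (by omega) (by omega)
  rw [Int.toNat_of_nonneg (by omega), Int.toNat_of_nonneg (by omega),
    Int.toNat_of_nonneg (by omega)] at this
  exact p (this p')

end

lemma lt_card_filter (P : ℕ → Prop) [DecidablePred P] (c : ℕ)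
    (hP : ∀ x y, x ≤ y → P y → P x) (r : ℕ) :
    r < ((Finset.range c).filter P).card ↔ r < c ∧ P r := by
  constructor
  · intro hlt
    by_contra hn
    have : (Finset.range c).filter P ⊆ Finset.range r := by
      intro x hx
      simp only [Finset.mem_filter, Finset.mem_range] at hx ⊢
      by_contra hxr
      exact hn ⟨by omega, hP r x (by omega) hx.2⟩
    have := Finset.card_le_card this
    rw [Finset.card_range] at this; omega
  · rintro ⟨h1, h2⟩
    have : Finset.range (r+1) ⊆ (Finset.range c).filter P := by
      intro x hx
      simp only [Finset.mem_filter, Finset.mem_range] at hx ⊢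
      exact ⟨by omega, hP x r (by omega) h2⟩
    have := Finset.card_le_card this
    rw [Finset.card_range] at this; omega

abbrev PP (a b c : ℕ) := {p : Fin a → Fin b → Fin (c + 1) //
    ∀ i i' j j', i ≤ i' → j ≤ j' → (p i' j' : ℕ) ≤ (p i j : ℕ)}

abbrev NT (a b c : ℕ) := {N : ℤ → ℤ → ℤ // IsN a b c N}

def ppOf {a b c : ℕ} (N : NT a b c) : PP a b c :=
  ⟨fun s t => ⟨((Finset.range c).filter
      (fun r : ℕ => 0 < Nt a b N.1 ((s : ℕ) : ℤ) ((t : ℕ) : ℤ) r)).card, by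
    have := Finset.card_filter_le (Finset.range c)
      (fun r : ℕ => 0 < Nt a b N.1 ((s : ℕ) : ℤ) ((t : ℕ) : ℤ) r)
    rw [Finset.card_range] at this; omega⟩, by
    intro s s' t t' hs ht
    dsimp only
    refine Finset.card_le_card ?_
    intro r hr
    simp only [Finset.mem_filter] at hr ⊢
    refine ⟨hr.1, lt_of_lt_of_le hr.2 (Nt_mono N.2 ?_ ?_ le_rfl)⟩
    · exact_mod_cast hs
    · exact_mod_cast ht⟩

lemma ppOf_spec {a b c : ℕ} (N : NT a b c) (s t r : ℕ) (hs : s < a) (ht : t < b) (hr : r < c) :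
    0 < Nt a b N.1 s t r ↔ r < ((ppOf N).1 ⟨s, hs⟩ ⟨t, ht⟩ : ℕ) := by
  have := lt_card_filter (fun r : ℕ => 0 < Nt a b N.1 (s : ℤ) (t : ℤ) r) c (by
    intro x y hxy hy
    exact lt_of_lt_of_le hy (Nt_mono N.2 le_rfl le_rfl (by exact_mod_cast hxy))) r
  exact ((and_iff_right hr).symm.trans this.symm)

lemma ppOf_inj (a b c : ℕ) : Function.Injective (ppOf : NT a b c → PP a b c) := by
  intro N N' e
  apply Subtype.ext
  funext i j
  apply le_antisymm
  · apply N_le_of N'.2 N.2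
    intro s t r hs ht hr
    rw [ppOf_spec N s t r hs ht hr, ppOf_spec N' s t r hs ht hr, e]; exact id
  · apply N_le_of N.2 N'.2
    intro s t r hs ht hr
    rw [ppOf_spec N s t r hs ht hr, ppOf_spec N' s t r hs ht hr, e]; exact id

/-! ### plane partitions to height functions -/

def ext {a b c : ℕ} (p : PP a b c) (s t : ℕ) : ℕ :=
  if h : s < a ∧ t < b then (p.1 ⟨s, h.1⟩ ⟨t, h.2⟩ : ℕ) else 0

lemma ext_box {a b c : ℕ} (p : PP a b c) {s t r : ℕ} (h : r < ext p s t) :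
    s < a ∧ t < b ∧ r < c := by
  unfold ext at h
  split_ifs at h with h1
  · have := (p.1 ⟨s, h1.1⟩ ⟨t, h1.2⟩).2
    exact ⟨h1.1, h1.2, by omega⟩
  · omega

lemma ext_anti {a b c : ℕ} (p : PP a b c) {s t s' t' : ℕ} (hs : s ≤ s') (ht : t ≤ t') :
    ext p s' t' ≤ ext p s t := by
  unfold ext
  split_ifs with h1 h2
  · exact p.2 _ _ _ _ (by simpa using hs) (by simpa using ht)
  · omega
  · omega
  · omega

lemma ext_down {a b c : ℕ} (p : PP a b c) {s t r s' t' r' : ℕ} (hs : s ≤ s') (ht : t ≤ t')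
    (hr : r ≤ r') (h : r' < ext p s' t') : r < ext p s t := by
  have := ext_anti p hs ht; omega

def bs (a b : ℕ) (i j : ℤ) : ℕ := (-(min 0 (min ((b:ℤ)-1-i) (j-a+1)))).toNat
def bt (a b : ℕ) (i j : ℤ) : ℕ := (-(min 0 (min ((b:ℤ)-1-i) (j-a+1))) + (b-1-i)).toNat
def br (a b : ℕ) (i j : ℤ) : ℕ := (-(min 0 (min ((b:ℤ)-1-i) (j-a+1))) + (j-a+1)).toNat

def NP {a b c : ℕ} (p : PP a b c) (i j : ℤ) : ℤ :=
  ((Finset.range a).filter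
    (fun n => br a b i j + n < ext p (bs a b i j + n) (bt a b i j + n))).card

lemma NP_nonneg {a b c : ℕ} (p : PP a b c) (i j : ℤ) : 0 ≤ NP p i j := by
  unfold NP; omega

lemma NP_base {a b c : ℕ} (p : PP a b c) (i j : ℤ) (n : ℕ) :
    (n : ℤ) < NP p i j ↔ br a b i j + n < ext p (bs a b i j + n) (bt a b i j + n) := by
  unfold NP
  rw [Nat.cast_lt, lt_card_filter (fun n => br a b i j + n < ext p (bs a b i j + n)
    (bt a b i j + n)) a]
  · constructor
    · exact fun h => h.2
    · intro h
      exact ⟨by have := ext_box p h; omega, h⟩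
  · intro x y hxy hy
    exact ext_down p (by omega) (by omega) (by omega) hy

lemma NP_spec {a b c : ℕ} (p : PP a b c) (s t r : ℕ) (i j : ℤ) (hi : i = (s:ℤ) - t + b - 1)
    (hj : j = (r:ℤ) - s + a - 1) :
    ((min s (min t r) : ℕ) : ℤ) < NP p i j ↔ r < ext p s t := by
  rw [NP_base]
  have e1 : bs a b i j + min s (min t r) = s := by unfold bs; omega
  have e2 : bt a b i j + min s (min t r) = t := by unfold bt; omega
  have e3 : br a b i j + min s (min t r) = r := by unfold br; omega
  rw [e1, e2, e3]

lemma NP_point {a b c : ℕ} (p : PP a b c) (i j : ℤ) (n : ℤ) (h0 : 0 ≤ n) (h : n < NP p i j) :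
    ∃ s t r : ℕ, s < a ∧ t < b ∧ r < c ∧ i = (s:ℤ) - t + b - 1 ∧ j = (r:ℤ) - s + a - 1 ∧
      ((min s (min t r) : ℕ) : ℤ) = n ∧ r < ext p s t := by
  lift n to ℕ using h0
  rw [NP_base] at h
  have hb := ext_box p h
  refine ⟨_, _, _, hb.1, hb.2.1, hb.2.2, ?_, ?_, ?_, h⟩ <;> simp only [bs, bt, br] <;> omega

lemma NP_zero {a b c : ℕ} (p : PP a b c) (i j : ℤ)
    (h : i < 0 ∨ (a:ℤ) + b - 1 ≤ i ∨ j < 0 ∨ (a:ℤ) + c - 1 ≤ j) : NP p i j = 0 := by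
  by_contra hn
  have := NP_nonneg p i j
  obtain ⟨s, t, r, _⟩ := NP_point p i j 0 le_rfl (by omega)
  omega

lemma NP_isN {a b c : ℕ} (p : PP a b c) : IsN a b c (NP p) := by
  constructor
  · intro i j
    by_contra hn
    have h0 := NP_nonneg p i (j-1)
    obtain ⟨s, t, r, hs, ht, hr, hi, hj, hm, hI⟩ := NP_point p i j
      (NP p i (j-1) + Xr a b i j) (by have := (ref_isT a b c).hX i j; omega) (by omega)
    have hr1 : 1 ≤ r := by unfold Xr at hm; split_ifs at hm <;> omega
    have := (NP_spec p s t (r-1) i (j-1) (by omega) (by omega)).2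
      (ext_down p le_rfl le_rfl (by omega) hI)
    unfold Xr at hm; split_ifs at hm <;> omega
  · intro i j
    by_contra hn
    have h0 := NP_nonneg p i j
    obtain ⟨s, t, r, hs, ht, hr, hi, hj, hm, hI⟩ := NP_point p (i-1) j
      (NP p i j + Yr a b c i j) (by have := (ref_isT a b c).hY i j; omega) (by omega)
    have hr1 : 1 ≤ t := by unfold Yr at hm; split_ifs at hm <;> omega
    have := (NP_spec p s (t-1) r i j (by omega) (by omega)).2
      (ext_down p le_rfl (by omega) le_rfl hI)
    unfold Yr at hm; split_ifs at hm <;> omega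
  · intro i j
    by_contra hn
    have h0 := NP_nonneg p (i-1) j
    obtain ⟨s, t, r, hs, ht, hr, hi, hj, hm, hI⟩ := NP_point p i (j-1)
      (NP p (i-1) j + Zr a b c i j) (by have := (ref_isT a b c).hZ i j; omega) (by omega)
    have hr1 : 1 ≤ s := by unfold Zr at hm; split_ifs at hm <;> omega
    have := (NP_spec p (s-1) t r (i-1) j (by omega) (by omega)).2
      (ext_down p (by omega) le_rfl le_rfl hI)
    unfold Zr at hm; split_ifs at hm <;> omega
  · intro i j h; exact NP_zero p i j (by omega)
  · intro i j h; exact NP_zero p i j (by omega)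
  · intro i j h; exact NP_zero p i j (by omega)
  · intro i j h; exact NP_zero p i j (by omega)

def nOf {a b c : ℕ} (p : PP a b c) : NT a b c := ⟨NP p, NP_isN p⟩

lemma nOf_inj (a b c : ℕ) : Function.Injective (nOf : PP a b c → NT a b c) := by
  intro p q e
  have e' : NP p = NP q := congrArg Subtype.val e
  have key : ∀ s t r : ℕ, r < ext p s t ↔ r < ext q s t := by
    intro s t r
    rw [← NP_spec p s t r _ _ rfl rfl, ← NP_spec q s t r _ _ rfl rfl, e']
  apply Subtype.ext
  funext s t
  apply Fin.ext
  have h1 : ext p s t = ext q s t := by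
    have k1 := key s t (ext p s t)
    have k2 := key s t (ext q s t)
    omega
  simpa [ext] using h1

/-! ### tilings and matchings -/

abbrev TT (a b c : ℕ) := {T : (ℤ → ℤ → ℤ) × (ℤ → ℤ → ℤ) × (ℤ → ℤ → ℤ) //
  IsT a b c T.1 T.2.1 T.2.2}

def tOf {a b c : ℕ} (N : NT a b c) : TT a b c := ⟨(_, _, _), N.2.toT⟩

lemma tOf_inj (a b c : ℕ) : Function.Injective (tOf : NT a b c → TT a b c) := by
  intro N N' e
  apply Subtype.ext
  apply IsN.toT_inj N.2 N'.2
  intro i j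
  have := congrArg (fun T => T.1.1 i j) e
  exact this

noncomputable def nOfT {a b c : ℕ} (T : TT a b c) : NT a b c := ⟨_, T.2.toN⟩

lemma nOfT_inj (a b c : ℕ) : Function.Injective (nOfT : TT a b c → NT a b c) := by
  rintro ⟨⟨X, Y, Z⟩, h⟩ ⟨⟨X', Y', Z'⟩, h'⟩ e
  have e' : Nof a b c X = Nof a b c X' := congrArg Subtype.val e
  have eX : X = X' := by
    funext i j
    have h1 := Nof_X h i j; have h2 := Nof_X h' i j
    dsimp only at h1 h2
    rw [e'] at h1; omega
  have eY : Y = Y' := by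
    funext i j
    have h1 := Nof_Y h i j; have h2 := Nof_Y h' i j
    dsimp only at h1 h2
    rw [e'] at h1; omega
  have eZ : Z = Z' := by
    funext i j
    have h1 := h.hW i j; have h2 := h'.hW i j
    dsimp only at h1 h2
    rw [eX, eY] at h1; omega
  subst eX eY eZ; rfl

abbrev MM (a b c : ℕ) :=
  {σ : Mon (a+b) (a+c) (b+c) (a+b+c-2) ≃ Mon (a+b) (a+c) (b+c) (a+b+c-2+1) //
        ∀ v, (v.1.1 : ℕ) ≤ ((σ v).1.1 : ℕ) ∧ (v.1.2.1 : ℕ) ≤ ((σ v).1.2.1 : ℕ) ∧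
          (v.1.2.2 : ℕ) ≤ ((σ v).1.2.2 : ℕ)}

lemma Mon_ext {A B C s : ℕ} {v w : Mon A B C s} (h1 : (v.1.1 : ℕ) = w.1.1)
    (h2 : (v.1.2.1 : ℕ) = w.1.2.1) : v = w := by
  have := v.2; have := w.2
  apply Subtype.ext
  refine Prod.ext (Fin.ext h1) (Prod.ext (Fin.ext h2) (Fin.ext ?_))
  omega

lemma Mon_mk {A B C s : ℕ} (i j k : ℕ) (hi : i < A) (hj : j < B) (hk : k < C)
    (h : i + j + k = s) : ∃ v : Mon A B C s, (v.1.1 : ℕ) = i ∧ (v.1.2.1 : ℕ) = j :=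
  ⟨⟨(⟨i, hi⟩, ⟨j, hj⟩, ⟨k, hk⟩), h⟩, rfl, rfl⟩


def At {A B C s : ℕ} (v : Mon A B C s) (i j : ℤ) : Prop :=
  ((v.1.1 : ℕ) : ℤ) = i ∧ ((v.1.2.1 : ℕ) : ℤ) = j

lemma At.eq {A B C s : ℕ} {v w : Mon A B C s} {i j : ℤ} (hv : At v i j) (hw : At w i j) :
    v = w := by
  obtain ⟨h1, h2⟩ := hv
  obtain ⟨h3, h4⟩ := hw
  exact Mon_ext (by omega) (by omega)

section
variable {a b c : ℕ}

abbrev M0 (a b c : ℕ) := Mon (a+b) (a+c) (b+c) (a+b+c-2)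
abbrev M1 (a b c : ℕ) := Mon (a+b) (a+c) (b+c) (a+b+c-2+1)

lemma At.W (ha : 1 ≤ a) (hb : 1 ≤ b) {v : M0 a b c} {i j : ℤ} (h : At v i j) :
    Wt a b c i j = 1 := by
  obtain ⟨h1, h2⟩ := h
  have := v.2
  have := v.1.1.2; have := v.1.2.1.2; have := v.1.2.2.2
  unfold Wt
  rw [if_pos]; omega

lemma At.B (ha : 1 ≤ a) (hb : 1 ≤ b) {v : M1 a b c} {i j : ℤ} (h : At v i j) :
    Bt a b c i j = 1 := by
  obtain ⟨h1, h2⟩ := h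
  have := v.2
  have := v.1.1.2; have := v.1.2.1.2; have := v.1.2.2.2
  unfold Bt
  rw [if_pos]; omega

lemma exists_W (ha : 1 ≤ a) (hb : 1 ≤ b) {i j : ℤ} (h : Wt a b c i j ≠ 0) :
    ∃ v : M0 a b c, At v i j := by
  unfold Wt at h
  split_ifs at h with h'
  · obtain ⟨v, h1, h2⟩ := Mon_mk (A := a+b) (B := a+c) (C := b+c) (s := a+b+c-2)
      i.toNat j.toNat ((a:ℤ)+b+c-2-i-j).toNat
      (by omega) (by omega) (by omega) (by omega)
    exact ⟨v, by omega, by omega⟩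
  · exact absurd rfl h

lemma exists_B (ha : 1 ≤ a) (hb : 1 ≤ b) {i j : ℤ} (h : Bt a b c i j ≠ 0) :
    ∃ v : M1 a b c, At v i j := by
  unfold Bt at h
  split_ifs at h with h'
  · obtain ⟨v, h1, h2⟩ := Mon_mk (A := a+b) (B := a+c) (C := b+c) (s := a+b+c-2+1)
      i.toNat j.toNat ((a:ℤ)+b+c-1-i-j).toNat
      (by omega) (by omega) (by omega) (by omega)
    exact ⟨v, by omega, by omega⟩
  · exact absurd rfl h

lemma at_self {A B C s : ℕ} (v : Mon A B C s) :
    At v ((v.1.1 : ℕ) : ℤ) ((v.1.2.1 : ℕ) : ℤ) := ⟨rfl, rfl⟩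

/-- `v` is matched with `w` in the tiling `T`. -/
def R (T : TT a b c) (v : M0 a b c) (w : M1 a b c) : Prop :=
  ∃ i j : ℤ, At v i j ∧ ((T.1.1 i j = 1 ∧ At w (i+1) j) ∨ (T.1.2.1 i j = 1 ∧ At w i (j+1)) ∨
    (T.1.2.2 i j = 1 ∧ At w i j))

lemma Wt_le (i j : ℤ) : Wt a b c i j ≤ 1 := by unfold Wt; split_ifs <;> omega
lemma Bt_le (i j : ℤ) : Bt a b c i j ≤ 1 := by unfold Bt; split_ifs <;> omega

lemma R_exists (ha : 1 ≤ a) (hb : 1 ≤ b) (T : TT a b c) (v : M0 a b c) : ∃ w, R T v w := by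
  have hv := at_self v
  generalize ((v.1.1 : ℕ) : ℤ) = i at hv
  generalize ((v.1.2.1 : ℕ) : ℤ) = j at hv
  have h := T.2
  have hw := hv.W ha hb
  have e := h.hW i j
  have := h.hX i j; have := h.hY i j; have := h.hZ i j
  rcases (by omega : T.1.1 i j = 1 ∨ T.1.2.1 i j = 1 ∨ T.1.2.2 i j = 1) with h1 | h1 | h1
  · have e := h.hB (i+1) j
    rw [add_sub_cancel_right] at e
    have := h.hY (i+1) (j-1); have := h.hZ (i+1) j
    obtain ⟨w, hw⟩ := exists_B ha hb (a := a) (b := b) (c := c) (i := i+1) (j := j) (by omega)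
    exact ⟨w, i, j, hv, Or.inl ⟨h1, hw⟩⟩
  · have e := h.hB i (j+1)
    rw [add_sub_cancel_right] at e
    have := h.hX (i-1) (j+1); have := h.hZ i (j+1)
    obtain ⟨w, hw⟩ := exists_B ha hb (a := a) (b := b) (c := c) (i := i) (j := j+1) (by omega)
    exact ⟨w, i, j, hv, Or.inr (Or.inl ⟨h1, hw⟩)⟩
  · have e := h.hB i j
    have := h.hX (i-1) j; have := h.hY i (j-1)
    obtain ⟨w, hw⟩ := exists_B ha hb (a := a) (b := b) (c := c) (i := i) (j := j) (by omega)
    exact ⟨w, i, j, hv, Or.inr (Or.inr ⟨h1, hw⟩)⟩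

lemma R_exists' (ha : 1 ≤ a) (hb : 1 ≤ b) (T : TT a b c) (w : M1 a b c) : ∃ v, R T v w := by
  have hv := at_self w
  generalize ((w.1.1 : ℕ) : ℤ) = i at hv
  generalize ((w.1.2.1 : ℕ) : ℤ) = j at hv
  have h := T.2
  have hw := hv.B ha hb
  have e := h.hB i j
  have := h.hX (i-1) j; have := h.hY i (j-1); have := h.hZ i j
  rcases (by omega : T.1.1 (i-1) j = 1 ∨ T.1.2.1 i (j-1) = 1 ∨ T.1.2.2 i j = 1) with h1 | h1 | h1
  · obtain ⟨v, hv'⟩ := exists_W ha hb (a := a) (b := b) (c := c) (i := i-1) (j := j) (by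
      intro h0; have := (h.supp _ _ h0).1; omega)
    exact ⟨v, _, _, hv', Or.inl ⟨h1, by rwa [sub_add_cancel]⟩⟩
  · obtain ⟨v, hv'⟩ := exists_W ha hb (a := a) (b := b) (c := c) (i := i) (j := j-1) (by
      intro h0; have := (h.supp _ _ h0).2.1; omega)
    exact ⟨v, _, _, hv', Or.inr (Or.inl ⟨h1, by rwa [sub_add_cancel]⟩)⟩
  · obtain ⟨v, hv'⟩ := exists_W ha hb (a := a) (b := b) (c := c) (i := i) (j := j) (by
      intro h0; have := (h.supp _ _ h0).2.2; omega)
    exact ⟨v, _, _, hv', Or.inr (Or.inr ⟨h1, hv⟩)⟩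

lemma At.coord {A B C s : ℕ} {v : Mon A B C s} {i j i' j' : ℤ} (h : At v i j) (h' : At v i' j') :
    i = i' ∧ j = j' := ⟨h.1.symm.trans h'.1, h.2.symm.trans h'.2⟩

lemma R_fun (T : TT a b c) {v : M0 a b c} {w w' : M1 a b c}
    (h : R T v w) (h' : R T v w') : w = w' := by
  obtain ⟨i, j, hv, h⟩ := h
  obtain ⟨i', j', hv', h'⟩ := h'
  obtain ⟨rfl, rfl⟩ := hv.coord hv'
  have e := T.2.hW i j
  have := T.2.hX i j; have := T.2.hY i j; have := T.2.hZ i j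
  have := Wt_le (a := a) (b := b) (c := c) i j
  rcases h with ⟨h, k⟩ | ⟨h, k⟩ | ⟨h, k⟩ <;> rcases h' with ⟨h', k'⟩ | ⟨h', k'⟩ | ⟨h', k'⟩ <;>
    first
      | exact k.eq k'
      | (exfalso; omega)

lemma R_back (T : TT a b c) {v : M0 a b c} {w : M1 a b c} {i j : ℤ} (hw : At w i j)
    (h : R T v w) : (T.1.1 (i-1) j = 1 ∧ At v (i-1) j) ∨ (T.1.2.1 i (j-1) = 1 ∧ At v i (j-1)) ∨
      (T.1.2.2 i j = 1 ∧ At v i j) := by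
  obtain ⟨i', j', hv, h⟩ := h
  rcases h with ⟨h, k⟩ | ⟨h, k⟩ | ⟨h, k⟩
  · obtain ⟨rfl, rfl⟩ := hw.coord k
    simp only [add_sub_cancel_right]; exact Or.inl ⟨h, hv⟩
  · obtain ⟨rfl, rfl⟩ := hw.coord k
    simp only [add_sub_cancel_right]; exact Or.inr (Or.inl ⟨h, hv⟩)
  · obtain ⟨rfl, rfl⟩ := hw.coord k
    exact Or.inr (Or.inr ⟨h, hv⟩)

lemma R_inj (T : TT a b c) {v v' : M0 a b c} {w : M1 a b c}
    (h : R T v w) (h' : R T v' w) : v = v' := by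
  have hw := at_self w
  generalize ((w.1.1 : ℕ) : ℤ) = i at hw
  generalize ((w.1.2.1 : ℕ) : ℤ) = j at hw
  have h := R_back T hw h
  have h' := R_back T hw h'
  have e := T.2.hB i j
  have := T.2.hX (i-1) j; have := T.2.hY i (j-1); have := T.2.hZ i j
  have := Bt_le (a := a) (b := b) (c := c) i j
  rcases h with ⟨h, k⟩ | ⟨h, k⟩ | ⟨h, k⟩ <;> rcases h' with ⟨h', k'⟩ | ⟨h', k'⟩ | ⟨h', k'⟩ <;>
    first
      | exact k.eq k'
      | (exfalso; omega)

lemma R_dvd (T : TT a b c) {v : M0 a b c} {w : M1 a b c} (h : R T v w) :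
    (v.1.1 : ℕ) ≤ (w.1.1 : ℕ) ∧ (v.1.2.1 : ℕ) ≤ (w.1.2.1 : ℕ) ∧
          (v.1.2.2 : ℕ) ≤ (w.1.2.2 : ℕ) := by
  obtain ⟨i, j, ⟨h1, h2⟩, h⟩ := h
  have := v.2; have := w.2
  rcases h with ⟨_, h3, h4⟩ | ⟨_, h3, h4⟩ | ⟨_, h3, h4⟩ <;> omega

lemma exists_match (ha : 1 ≤ a) (hb : 1 ≤ b) (T : TT a b c) :
    ∃ M : MM a b c, ∀ v, R T v (M.1 v) := by
  choose f hf using R_exists ha hb T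
  have hbij : Function.Bijective f := by
    constructor
    · intro v v' e
      exact R_inj T (hf v) (e ▸ hf v')
    · intro w
      obtain ⟨v, hv⟩ := R_exists' ha hb T w
      exact ⟨v, R_fun T (hf v) hv⟩
  exact ⟨⟨Equiv.ofBijective f hbij, fun v => R_dvd T (hf v)⟩, hf⟩

lemma R_determines (ha : 1 ≤ a) (hb : 1 ≤ b) (T T' : TT a b c) (M : MM a b c)
    (h : ∀ v, R T v (M.1 v)) (h' : ∀ v, R T' v (M.1 v)) : T = T' := by
  have key : ∀ i j, T.1.1 i j = T'.1.1 i j ∧ T.1.2.1 i j = T'.1.2.1 i j ∧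
      T.1.2.2 i j = T'.1.2.2 i j := by
    intro i j
    by_cases hw : Wt a b c i j = 0
    · have h1 := T.2.supp _ _ hw; have h2 := T'.2.supp _ _ hw
      omega
    · obtain ⟨v, hv⟩ := exists_W ha hb hw
      obtain ⟨i1, j1, k1, h1⟩ := h v
      obtain ⟨i2, j2, k2, h2⟩ := h' v
      obtain ⟨rfl, rfl⟩ := hv.coord k1
      obtain ⟨rfl, rfl⟩ := hv.coord k2
      have := T.2.hW i j
      have := T.2.hX i j; have := T.2.hY i j; have := T.2.hZ i j
      have := T'.2.hW i j
      have := T'.2.hX i j; have := T'.2.hY i j; have := T'.2.hZ i j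
      have := Wt_le (a := a) (b := b) (c := c) i j
      rcases h1 with ⟨h1, k⟩ | ⟨h1, k⟩ | ⟨h1, k⟩ <;>
        rcases h2 with ⟨h2, k'⟩ | ⟨h2, k'⟩ | ⟨h2, k'⟩ <;>
        have := k.coord k' <;> omega
  apply Subtype.ext
  refine Prod.ext ?_ (Prod.ext ?_ ?_)
  · funext i j; exact (key i j).1
  · funext i j; exact (key i j).2.1
  · funext i j; exact (key i j).2.2

/-! matchings to tilings -/

def Q (M : MM a b c) (i j i' j' : ℤ) : Prop := ∃ v, At v i j ∧ At (M.1 v) i' j'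

lemma Q_left (M : MM a b c) {v : M0 a b c} {i j : ℤ} (hv : At v i j) (i' j' : ℤ) :
    Q M i j i' j' ↔ At (M.1 v) i' j' := by
  constructor
  · rintro ⟨v', h1, h2⟩
    rwa [hv.eq h1]
  · exact fun h => ⟨v, hv, h⟩

lemma Q_right (M : MM a b c) {w : M1 a b c} {i' j' : ℤ} (hw : At w i' j') (i j : ℤ) :
    Q M i j i' j' ↔ At (M.1.symm w) i j := by
  constructor
  · rintro ⟨v', h1, h2⟩
    rwa [hw.eq h2, Equiv.symm_apply_apply]
  · exact fun h => ⟨_, h, by rwa [Equiv.apply_symm_apply]⟩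

open Classical in
noncomputable def QX (M : MM a b c) (i j : ℤ) : ℤ := if Q M i j (i+1) j then 1 else 0
open Classical in
noncomputable def QY (M : MM a b c) (i j : ℤ) : ℤ := if Q M i j i (j+1) then 1 else 0
open Classical in
noncomputable def QZ (M : MM a b c) (i j : ℤ) : ℤ := if Q M i j i j then 1 else 0

open Classical in
noncomputable def ind (p : Prop) : ℤ := if p then 1 else 0

lemma ind_pos {p : Prop} (h : p) : ind p = 1 := if_pos h
lemma ind_neg {p : Prop} (h : ¬ p) : ind p = 0 := if_neg h

lemma Q_left3 (M : MM a b c) {v : M0 a b c} {i j : ℤ} (hv : At v i j) :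
    QX M i j = ind (At (M.1 v) (i+1) j) ∧ QY M i j = ind (At (M.1 v) i (j+1)) ∧
      QZ M i j = ind (At (M.1 v) i j) :=
  ⟨congrArg ind (propext (Q_left M hv _ _)), congrArg ind (propext (Q_left M hv _ _)),
    congrArg ind (propext (Q_left M hv _ _))⟩

lemma Q_right3 (M : MM a b c) {w : M1 a b c} {i j : ℤ} (hw : At w i j) :
    QX M (i-1) j = ind (At (M.1.symm w) (i-1) j) ∧ QY M i (j-1) = ind (At (M.1.symm w) i (j-1)) ∧
      QZ M i j = ind (At (M.1.symm w) i j) := by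
  refine ⟨congrArg ind (propext ?_), congrArg ind (propext ?_),
    congrArg ind (propext (Q_right M hw _ _))⟩
  · rw [sub_add_cancel]; exact Q_right M hw _ _
  · rw [sub_add_cancel]; exact Q_right M hw _ _

lemma Q_isT (ha : 1 ≤ a) (hb : 1 ≤ b) (M : MM a b c) :
    IsT a b c (QX M) (QY M) (QZ M) := by
  constructor
  · intro i j; unfold QX; split_ifs <;> omega
  · intro i j; unfold QY; split_ifs <;> omega
  · intro i j; unfold QZ; split_ifs <;> omega
  · intro i j
    by_cases hw : Wt a b c i j = 0
    · have hn : ∀ i' j', ¬ Q M i j i' j' := by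
        rintro i' j' ⟨v, hv, _⟩
        have := hv.W ha hb; omega
      simp [QX, QY, QZ, hn, hw]
    · obtain ⟨v, hv⟩ := exists_W ha hb hw
      rw [hv.W ha hb]
      rw [(Q_left3 M hv).1, (Q_left3 M hv).2.1, (Q_left3 M hv).2.2]
      obtain ⟨h1, h2⟩ := hv
      have := M.2 v
      have := v.2; have := (M.1 v).2
      unfold At ind
      split_ifs <;> omega
  · intro i j
    by_cases hw : Bt a b c i j = 0
    · have hn : ∀ i' j', ¬ Q M i' j' i j := by
        rintro i' j' ⟨v, _, hv⟩
        have := hv.B ha hb; omega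
      simp [QX, QY, QZ, hn, hw]
    · obtain ⟨v, hv⟩ := exists_B ha hb hw
      rw [hv.B ha hb]
      rw [(Q_right3 M hv).1, (Q_right3 M hv).2.1, (Q_right3 M hv).2.2]
      obtain ⟨h1, h2⟩ := hv
      have h3 := M.2 (M.1.symm v)
      rw [Equiv.apply_symm_apply] at h3
      have := v.2; have := (M.1.symm v).2
      unfold At ind
      split_ifs <;> omega

lemma Q_inj (M M' : MM a b c) (hX : QX M = QX M') (hY : QY M = QY M') (hZ : QZ M = QZ M') :
    M = M' := by
  apply Subtype.ext
  apply Equiv.ext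
  intro v
  have hv := at_self v
  have := M.2 v
  have := v.2; have := (M.1 v).2
  generalize hi : ((v.1.1 : ℕ) : ℤ) = i at hv
  generalize hj : ((v.1.2.1 : ℕ) : ℤ) = j at hv
  have hX := congrFun (congrFun hX i) j
  have hY := congrFun (congrFun hY i) j
  have hZ := congrFun (congrFun hZ i) j
  rw [(Q_left3 M hv).1, (Q_left3 M' hv).1] at hX
  rw [(Q_left3 M hv).2.1, (Q_left3 M' hv).2.1] at hY
  rw [(Q_left3 M hv).2.2, (Q_left3 M' hv).2.2] at hZ
  have : At (M.1 v) (i+1) j ∨ At (M.1 v) i (j+1) ∨ At (M.1 v) i j := by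
    unfold At; omega
  rcases this with h | h | h
  · rw [ind_pos h] at hX
    by_cases h' : At (M'.1 v) (i+1) j
    · exact h.eq h'
    · rw [ind_neg h'] at hX; omega
  · rw [ind_pos h] at hY
    by_cases h' : At (M'.1 v) i (j+1)
    · exact h.eq h'
    · rw [ind_neg h'] at hY; omega
  · rw [ind_pos h] at hZ
    by_cases h' : At (M'.1 v) i j
    · exact h.eq h'
    · rw [ind_neg h'] at hZ; omega

end

theorem main (a b c : ℕ) (ha : 1 ≤ a) (hb : 1 ≤ b) :
    Fintype.card (PP a b c) = Fintype.card (MM a b c) := by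
  choose g hg using exists_match (c := c) ha hb
  have g_inj : Function.Injective g := by
    intro T T' e
    exact R_determines ha hb T T' (g T) (hg T) (e ▸ hg T')
  let q : MM a b c → TT a b c := fun M => ⟨(_, _, _), Q_isT ha hb M⟩
  have q_inj : Function.Injective q := by
    intro M M' e
    have e' := congrArg Subtype.val e
    exact Q_inj M M' (congrArg (fun T => T.1) e') (congrArg (fun T => T.2.1) e')
      (congrArg (fun T => T.2.2) e')
  apply le_antisymm
  · exact Fintype.card_le_of_injective _
      (g_inj.comp ((tOf_inj a b c).comp (nOf_inj a b c)))
  · exact Fintype.card_le_of_injective _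
      ((ppOf_inj a b c).comp ((nOfT_inj a b c).comp q_inj))

end HexPP

/-- The number of plane partitions in an `a × b × c` box equals the number of perfect
matchings of the bipartite honeycomb graph on the monomials of degrees `a+b+c-2` and
`a+b+c-1` nonzero in `ℤ[x,y,z]/(x^{a+b},y^{a+c},z^{b+c})`, with edges given by
divisibility (equivalently, rhombus tilings of the `a,b,c` hexagon). -/
theorem stmt12 (a b c : ℕ) (ha : 1 ≤ a) (hb : 1 ≤ b) (hc : 1 ≤ c) :
    PPcount a b c =
      Fintype.card {σ : Mon (a+b) (a+c) (b+c) (a+b+c-2) ≃ Mon (a+b) (a+c) (b+c) (a+b+c-2+1) //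
        ∀ v, (v.1.1 : ℕ) ≤ ((σ v).1.1 : ℕ) ∧ (v.1.2.1 : ℕ) ≤ ((σ v).1.2.1 : ℕ) ∧
          (v.1.2.2 : ℕ) ≤ ((σ v).1.2.2 : ℕ)} := by
  unfold PPcount
  convert HexPP.main a b c ha hb
end

section
/- Let a ≥ 1 and C_3 act cyclically on R = ℤ[x,y,z]/(x^{2a},y^{2a},z^{2a}); set m = 3a-2. In the orbit-sum basis of R^{C_3}, the orbit of x^a y^{a-1} z^{a-1} is the unique basis element of degree m whose image under multiplication by x+y+z has a coefficient 2 (namely, it maps to the orbit of x^{a+1} y^{a-1} z^{a-1} plus 2 times the orbit of x^a y^a z^{a-1}); all other matrix entries of the restricted map are 0 or 1. -/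
open Matrix

/-- The cyclic action `x → y → z → x` on monomials: `x^i y^j z^k ↦ x^k y^i z^j`. -/
def cyc {n s : ℕ} (v : Mon n n n s) : Mon n n n s :=
  ⟨(v.1.2.2, v.1.1, v.1.2.1), by have := v.2; dsimp at this ⊢; omega⟩

/-- The orbit sum (under the cyclic action `x → y → z → x`) of the monomial
`x^i y^j z^k` in `ℤ[x,y,z]/(x^n,y^n,z^n)`, as a coordinate vector on the degree-`s`
monomial basis (it is zero at monomials outside the orbit, and in particular the
whole vector is zero if the monomial is zero in the quotient ring). -/
def orbitSum (n s i j k : ℕ) : Mon n n n s → ℤ := fun w =>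
  if ((w.1.1 : ℕ), (w.1.2.1 : ℕ), (w.1.2.2 : ℕ)) = (i, j, k) ∨
     ((w.1.1 : ℕ), (w.1.2.1 : ℕ), (w.1.2.2 : ℕ)) = (k, i, j) ∨
     ((w.1.1 : ℕ), (w.1.2.1 : ℕ), (w.1.2.2 : ℕ)) = (j, k, i) then 1 else 0

/-- The monomial with given exponents. -/
def mkMon (n s x y z : ℕ) (hx : x < n) (hy : y < n) (hz : z < n) (hs : x + y + z = s) :
    Mon n n n s := ⟨(⟨x, hx⟩, ⟨y, hy⟩, ⟨z, hz⟩), hs⟩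

theorem single_mkMon (n s x y z : ℕ) (hx : x < n) (hy : y < n) (hz : z < n)
    (hs : x + y + z = s) (w : Mon n n n s) :
    (Pi.single (mkMon n s x y z hx hy hz hs) (1 : ℤ) : Mon n n n s → ℤ) w
      = if (w.1.1 : ℕ) = x ∧ (w.1.2.1 : ℕ) = y ∧ (w.1.2.2 : ℕ) = z then 1 else 0 := by
  rw [Pi.single_apply]
  refine if_congr ?_ rfl rfl
  constructor
  · rintro rfl
    exact ⟨rfl, rfl, rfl⟩
  · rintro ⟨h1, h2, h3⟩
    exact Subtype.ext (Prod.ext (Fin.ext h1) (Prod.ext (Fin.ext h2) (Fin.ext h3)))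

theorem orbitSum_eq_single (n s i j k : ℕ) (hi : i < n) (hj : j < n) (hk : k < n)
    (h : i + j + k = s) (hne : ¬ (i = j ∧ j = k)) :
    orbitSum n s i j k =
      Pi.single (mkMon n s i j k hi hj hk h) 1
      + Pi.single (mkMon n s k i j hk hi hj (by omega)) 1
      + Pi.single (mkMon n s j k i hj hk hi (by omega)) 1 := by
  funext w
  rw [Pi.add_apply, Pi.add_apply, single_mkMon, single_mkMon, single_mkMon]
  simp only [orbitSum, Prod.mk.injEq]
  generalize (w.1.1 : ℕ) = p
  generalize (w.1.2.1 : ℕ) = q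
  generalize (w.1.2.2 : ℕ) = r
  split_ifs <;> first | rfl | (exfalso; omega)

theorem mulVec_orbitSum (n s i j k : ℕ) (hi : i < n) (hj : j < n) (hk : k < n)
    (h : i + j + k = s) (hne : ¬ (i = j ∧ j = k)) (w : Mon n n n (s+1)) :
    (Umat n n n s).mulVec (orbitSum n s i j k) w =
      (if i ≤ (w.1.1 : ℕ) ∧ j ≤ (w.1.2.1 : ℕ) ∧ k ≤ (w.1.2.2 : ℕ) then 1 else 0)
      + (if k ≤ (w.1.1 : ℕ) ∧ i ≤ (w.1.2.1 : ℕ) ∧ j ≤ (w.1.2.2 : ℕ) then 1 else 0)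
      + (if j ≤ (w.1.1 : ℕ) ∧ k ≤ (w.1.2.1 : ℕ) ∧ i ≤ (w.1.2.2 : ℕ) then 1 else 0) := by
  rw [orbitSum_eq_single n s i j k hi hj hk h hne, Matrix.mulVec_add, Matrix.mulVec_add,
    Pi.add_apply, Pi.add_apply, Matrix.mulVec_single_one, Matrix.mulVec_single_one,
    Matrix.mulVec_single_one]
  rfl

/-- Two distinct cyclic shifts of `(i,j,k)` lie below a common `(p,q,r)` of degree one more
only if `(i,j,k)` is a shift of `(b+1,b,b)`. -/
theorem shift_aux (b i j k p q r : ℕ) (h : i + j + k = 3 * b + 1) (hw : p + q + r = 3 * b + 2)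
    (h1 : i ≤ p ∧ j ≤ q ∧ k ≤ r) (h2 : k ≤ p ∧ i ≤ q ∧ j ≤ r) :
    (i = b + 1 ∧ j = b ∧ k = b) ∨ (i = b ∧ j = b + 1 ∧ k = b) ∨
      (i = b ∧ j = b ∧ k = b + 1) := by
  obtain ⟨h1, h3, h4⟩ := h1
  obtain ⟨h2, h5, h6⟩ := h2
  have e1 : i ≤ k + 1 := by omega
  have e2 : k ≤ i + 1 := by omega
  have e3 : j ≤ i + 1 := by omega
  have e4 : i ≤ j + 1 := by omega
  have e5 : k ≤ j + 1 := by omega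
  have e6 : j ≤ k + 1 := by omega
  rcases (by omega : i = j ∨ i = j + 1 ∨ j = i + 1) with e | e | e <;>
  rcases (by omega : i = k ∨ i = k + 1 ∨ k = i + 1) with f | f | f <;> omega

set_option maxHeartbeats 4000000 in
theorem first_aux (b p q r : ℕ) (hw : p + q + r = 3 * b + 2) :
    ((if b + 1 ≤ p ∧ b ≤ q ∧ b ≤ r then 1 else 0)
      + (if b ≤ p ∧ b + 1 ≤ q ∧ b ≤ r then 1 else 0)
      + (if b ≤ p ∧ b ≤ q ∧ b + 1 ≤ r then 1 else 0) : ℤ) =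
    (if p = b + 1 + 1 ∧ q = b ∧ r = b ∨ p = b ∧ q = b + 1 + 1 ∧ r = b ∨
        p = b ∧ q = b ∧ r = b + 1 + 1 then 1 else 0)
    + 2 • (if p = b + 1 ∧ q = b + 1 ∧ r = b ∨ p = b ∧ q = b + 1 ∧ r = b + 1 ∨
        p = b + 1 ∧ q = b ∧ r = b + 1 then 1 else 0) := by
  by_cases hp : b ≤ p ∧ b ≤ q ∧ b ≤ r
  · obtain ⟨⟨p, rfl⟩, h2, h3⟩ := And.imp_left Nat.exists_eq_add_of_le hp
    obtain ⟨q, rfl⟩ := Nat.exists_eq_add_of_le h2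
    obtain ⟨r, rfl⟩ := Nat.exists_eq_add_of_le h3
    have hs : p + q + r = 2 := by omega
    have : p ≤ 2 := by omega
    have : q ≤ 2 := by omega
    clear hp h2 h3 hw
    interval_cases p <;> interval_cases q <;> first | omega | skip
    all_goals
      obtain rfl : r = _ := by first | exact (by omega : r = 0) | exact (by omega : r = 1) | exact (by omega : r = 2)
      simp [add_assoc]
  · rw [if_neg (by omega), if_neg (by omega), if_neg (by omega), if_neg (by omega),
      if_neg (by omega)]
    rfl

/-- In the orbit-sum basis of `R^{C₃}` for `R = ℤ[x,y,z]/(x^{2a},y^{2a},z^{2a})`,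
`m = 3a-2`: multiplication by `x+y+z` sends the orbit of `x^a y^{a-1} z^{a-1}` to the
orbit of `x^{a+1} y^{a-1} z^{a-1}` plus `2` times the orbit of `x^a y^a z^{a-1}`, and
this is the unique degree-`m` basis element producing a coefficient `2`: every other
orbit sum maps with all coefficients `0` or `1`. -/
theorem stmt14 (a : ℕ) (ha : 1 ≤ a) :
    (Umat (2*a) (2*a) (2*a) (3*a-2)).mulVec (orbitSum (2*a) (3*a-2) a (a-1) (a-1))
      = orbitSum (2*a) (3*a-2+1) (a+1) (a-1) (a-1)
        + 2 • orbitSum (2*a) (3*a-2+1) a a (a-1) ∧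
    (∀ i j k : ℕ, i < 2*a → j < 2*a → k < 2*a → i + j + k = 3*a-2 →
      ¬ ((i, j, k) = (a, a-1, a-1) ∨ (i, j, k) = (a-1, a, a-1) ∨
         (i, j, k) = (a-1, a-1, a)) →
      ∀ w, (Umat (2*a) (2*a) (2*a) (3*a-2)).mulVec (orbitSum (2*a) (3*a-2) i j k) w = 0 ∨
           (Umat (2*a) (2*a) (2*a) (3*a-2)).mulVec (orbitSum (2*a) (3*a-2) i j k) w = 1) := by
  obtain ⟨b, rfl⟩ : ∃ b, a = b + 1 := ⟨a - 1, by omega⟩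
  constructor
  · funext w
    rw [mulVec_orbitSum _ _ _ _ _ (by omega) (by omega) (by omega) (by omega) (by omega)]
    have hw := w.2
    rw [Pi.add_apply, Pi.smul_apply]
    simp only [orbitSum, Prod.mk.injEq]
    generalize (w.1.1 : ℕ) = p at hw ⊢
    generalize (w.1.2.1 : ℕ) = q at hw ⊢
    generalize (w.1.2.2 : ℕ) = r at hw ⊢
    have hw' : p + q + r = 3 * b + 2 := by omega
    clear hw
    simp only [Nat.add_sub_cancel]
    exact first_aux b p q r hw'
  · intro i j k hi hj hk h hne w
    rw [mulVec_orbitSum _ _ _ _ _ hi hj hk h (by clear hne; omega)]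
    have hw := w.2
    generalize (w.1.1 : ℕ) = p at hw ⊢
    generalize (w.1.2.1 : ℕ) = q at hw ⊢
    generalize (w.1.2.2 : ℕ) = r at hw ⊢
    simp only [Prod.mk.injEq, Nat.add_sub_cancel] at hne
    have hw' : p + q + r = 3 * b + 2 := by clear hne; omega
    have h' : i + j + k = 3 * b + 1 := by clear hne; omega
    have h12 := shift_aux b i j k p q r h' hw'
    have h23 := shift_aux b k i j p q r (by clear hne; omega) hw'
    have h31 := shift_aux b j k i p q r (by clear hne; omega) hw'
    by_cases hA : i ≤ p ∧ j ≤ q ∧ k ≤ r <;> by_cases hB : k ≤ p ∧ i ≤ q ∧ j ≤ r <;>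
      by_cases hC : j ≤ p ∧ k ≤ q ∧ i ≤ r
    · exact absurd (h12 hA hB) hne
    · exact absurd (h12 hA hB) hne
    · exfalso
      rcases h31 hC hA with ⟨e1, e2, e3⟩ | ⟨e1, e2, e3⟩ | ⟨e1, e2, e3⟩
      · exact hne (by simp only [e1, e2, e3, true_and, and_true, and_self, true_or, or_true])
      · exact hne (by simp only [e1, e2, e3, true_and, and_true, and_self, true_or, or_true])
      · exact hne (by simp only [e1, e2, e3, true_and, and_true, and_self, true_or, or_true])
    · right; rw [if_pos hA, if_neg hB, if_neg hC]; rfl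
    · exfalso
      rcases h23 hB hC with ⟨e1, e2, e3⟩ | ⟨e1, e2, e3⟩ | ⟨e1, e2, e3⟩
      · exact hne (by simp only [e1, e2, e3, true_and, and_true, and_self, true_or, or_true])
      · exact hne (by simp only [e1, e2, e3, true_and, and_true, and_self, true_or, or_true])
      · exact hne (by simp only [e1, e2, e3, true_and, and_true, and_self, true_or, or_true])
    · right; rw [if_neg hA, if_pos hB, if_neg hC]; rfl
    · right; rw [if_neg hA, if_neg hB, if_pos hC]; rfl
    · left; rw [if_neg hA, if_neg hB, if_neg hC]; rfl
end

section
/- In any rhombus tiling of the a×a×c hexagon that is symmetric under reflection about the vertical axis, every vertex on the axis of symmetry (corresponding to a monomial x^i y^j z^j) is matched to x^{i+1} y^j z^j; i.e., every flip-symmetric perfect matching of the honeycomb graph matches each axis monomial x^i y^j z^j of degree m to x^{i+1} y^j z^j. -/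
open Matrix

/-- The action swapping `y ↔ z` on monomials (for equal `y`- and `z`-exponent bounds). -/
def swapYZ {A B s : ℕ} (v : Mon A B B s) : Mon A B B s :=
  ⟨(v.1.1, v.1.2.2, v.1.2.1), by have := v.2; dsimp at this ⊢; omega⟩

/-- In any flip-symmetric perfect matching of the honeycomb graph of the
`a × a × c` hexagon (vertices: monomials of degrees `m = 2a+c-2` and `m+1` nonzero in
`ℤ[x,y,z]/(x^{2a},y^{a+c},z^{a+c})`; edges: divisibility), every vertex on the axis of
symmetry, i.e. every monomial `x^i y^j z^j` of degree `m`, is matched to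
`x^{i+1} y^j z^j`. -/
theorem stmt16 (a c : ℕ) (ha : 1 ≤ a) (hc : 1 ≤ c)
    (σ : Mon (2*a) (a+c) (a+c) (2*a+c-2) ≃ Mon (2*a) (a+c) (a+c) (2*a+c-2+1))
    (hdiv : ∀ v, (v.1.1 : ℕ) ≤ ((σ v).1.1 : ℕ) ∧ (v.1.2.1 : ℕ) ≤ ((σ v).1.2.1 : ℕ) ∧
      (v.1.2.2 : ℕ) ≤ ((σ v).1.2.2 : ℕ))
    (hsym : ∀ v, σ (swapYZ v) = swapYZ (σ v))
    (v : Mon (2*a) (a+c) (a+c) (2*a+c-2)) (hv : (v.1.2.1 : ℕ) = (v.1.2.2 : ℕ)) :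
    ((σ v).1.1 : ℕ) = (v.1.1 : ℕ) + 1 ∧ (σ v).1.2.1 = v.1.2.1 ∧ (σ v).1.2.2 = v.1.2.2 := by
  have hfix : swapYZ v = v := by
    apply Subtype.ext
    apply Prod.ext
    · rfl
    · apply Prod.ext
      · exact Fin.ext hv.symm
      · exact Fin.ext hv
  have h1 := hsym v
  rw [hfix] at h1
  have h2 : ((σ v).1.2.1 : ℕ) = ((σ v).1.2.2 : ℕ) :=
    congrArg (fun w : Mon (2*a) (a+c) (a+c) (2*a+c-2+1) => (w.1.2.1 : ℕ)) h1
  obtain ⟨d1, d2, d3⟩ := hdiv v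
  have s1 := v.2
  have s2 := (σ v).2
  refine ⟨?_, Fin.ext ?_, Fin.ext ?_⟩ <;> omega
end
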